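/- Let n ≥ 2, N = n(n−1)/2, let (i_1,…,i_N) be a reduced expression for the longest element w₀ of S_n with associated sequence of positive roots β_1,…,β_N, and let {μ_{ab}}_{1≤a<b≤n} be an ideal filling. Then there exist positive generalized Puiseux series m_1,…,m_N ∈ 𝐊 with Val(m_j) = μ_{β_j} for all j, such that the matrix y_{i_1}(m_1⁻¹)·y_{i_2}(m_2⁻¹)⋯y_{i_N}(m_N⁻¹) over 𝐊 is a Toeplitz matrix (its (a,b) entry depends only on a − b). -/

import Mathlib

open Matrix

/-- `yMat n 𝕂 i z` is the n×n identity matrix except entry (i+1, i) (1-based) equals `z`. -/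
def yMat (n : ℕ) (𝕂 : Type*) [Field 𝕂] (i : ℕ) (z : 𝕂) :
    Matrix (Fin n) (Fin n) 𝕂 :=
  fun a b => if a = b then 1 else if (a : ℕ) = i ∧ (b : ℕ) + 1 = i then z else 0

/-- `xMat n 𝕂 i z` is the n×n identity matrix except entry (i, i+1) (1-based) equals `z`. -/
def xMat (n : ℕ) (𝕂 : Type*) [Field 𝕂] (i : ℕ) (z : 𝕂) :
    Matrix (Fin n) (Fin n) 𝕂 :=
  fun a b => if a = b then 1 else if (a : ℕ) + 1 = i ∧ (b : ℕ) = i then z else 0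

/-- `xNegMat n 𝕂 i z` is the identity except the 2×2 block in rows/cols i, i+1 (1-based)
equals [[z⁻¹, 0], [1, z]]. -/
noncomputable def xNegMat (n : ℕ) (𝕂 : Type*) [Field 𝕂] (i : ℕ) (z : 𝕂) :
    Matrix (Fin n) (Fin n) 𝕂 :=
  fun a b =>
    if (a : ℕ) + 1 = i ∧ (b : ℕ) + 1 = i then z⁻¹
    else if (a : ℕ) = i ∧ (b : ℕ) = i then z
    else if (a : ℕ) = i ∧ (b : ℕ) + 1 = i then 1
    else if a = b then 1 else 0

/-- The matrix w̄₀ with (i, n+1−i) entry (−1)^(n−i) (1-based) and other entries 0. -/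
def w0bar (n : ℕ) (𝕂 : Type*) [Field 𝕂] : Matrix (Fin n) (Fin n) 𝕂 :=
  fun a b => if (a : ℕ) + (b : ℕ) = n - 1 then (-1 : 𝕂) ^ (n - 1 - (a : ℕ)) else 0

/-- s_k = Σ_{j=1}^{k−1} (n−j). -/
def sIdx (n k : ℕ) : ℕ := ∑ j ∈ Finset.Icc 1 (k - 1), (n - j)

/-- The word 𝐢₀ = (1,2,…,n−1, 1,2,…,n−2, …, 1,2, 1). -/
def wordI0 (n : ℕ) : List ℕ :=
  (List.range (n - 1)).flatMap (fun k => (List.range (n - 1 - k)).map (· + 1))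

/-- The word 𝐢′₀ = (n−1,…,1, n−1,…,2, …, n−1,n−2, n−1). -/
def wordI0' (n : ℕ) : List ℕ :=
  (List.range (n - 1)).flatMap (fun k => (List.range (n - 1 - k)).map (fun a => n - 1 - a))

/-- The simple reflection s_i = (i, i+1) (1-based) as a permutation of `Fin n`. -/
def sPerm (n i : ℕ) : Equiv.Perm (Fin n) :=
  if h : 1 ≤ i ∧ i < n then Equiv.swap ⟨i - 1, by omega⟩ ⟨i, h.2⟩ else 1

/-- The longest element of S_n, k ↦ n+1−k (1-based). -/
def w0Perm (n : ℕ) : Equiv.Perm (Fin n) where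
  toFun a := ⟨n - 1 - (a : ℕ), by have := a.isLt; omega⟩
  invFun a := ⟨n - 1 - (a : ℕ), by have := a.isLt; omega⟩
  left_inv a := by
    have := a.isLt
    apply Fin.ext
    show n - 1 - (n - 1 - (a : ℕ)) = (a : ℕ)
    omega
  right_inv a := by
    have := a.isLt
    apply Fin.ext
    show n - 1 - (n - 1 - (a : ℕ)) = (a : ℕ)
    omega

/-- Apply a permutation of `Fin n` to a 1-based label in {1, …, n}. -/
def permApp {n : ℕ} (σ : Equiv.Perm (Fin n)) (x : ℕ) : ℕ :=
  if h : 1 ≤ x ∧ x ≤ n then ((σ ⟨x - 1, by omega⟩ : Fin n) : ℕ) + 1 else x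


/-- The field of generalized Puiseux series. -/
abbrev GPS := HahnSeries ℝ ℝ

/-- The series `x` has no terms of exponent smaller than `g`. -/
def OrderGE (g : ℝ) (x : GPS) : Prop := ∀ a < g, x.coeff a = 0

namespace OrderGE

theorem iff_le_orderTop {g : ℝ} {x : GPS} : OrderGE g x ↔ (g : WithTop ℝ) ≤ x.orderTop := by
  rw [HahnSeries.le_orderTop_iff_forall]
  simp [OrderGE]

theorem zero (g : ℝ) : OrderGE g 0 := fun _ _ => rfl

theorem mono {g g' : ℝ} {x : GPS} (h : OrderGE g x) (hg : g' ≤ g) : OrderGE g' x :=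
  fun a ha => h a (ha.trans_le hg)

theorem add {g : ℝ} {x y : GPS} (hx : OrderGE g x) (hy : OrderGE g y) : OrderGE g (x + y) :=
  fun a ha => by simp [hx a ha, hy a ha]

theorem neg {g : ℝ} {x : GPS} (hx : OrderGE g x) : OrderGE g (-x) :=
  fun a ha => by simp [hx a ha]

theorem sub {g : ℝ} {x y : GPS} (hx : OrderGE g x) (hy : OrderGE g y) : OrderGE g (x - y) :=
  fun a ha => by simp [hx a ha, hy a ha]

theorem sum {ι : Type*} {s : Finset ι} {g : ℝ} {f : ι → GPS} (h : ∀ i ∈ s, OrderGE g (f i)) :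
    OrderGE g (∑ i ∈ s, f i) :=
  Finset.sum_induction f (OrderGE g) (fun _ _ => add) (zero g) h

theorem mul {g g' : ℝ} {x y : GPS} (hx : OrderGE g x) (hy : OrderGE g' y) :
    OrderGE (g + g') (x * y) := by
  rw [iff_le_orderTop] at *
  rw [HahnSeries.orderTop_mul, WithTop.coe_add]
  exact add_le_add hx hy

theorem single {g : ℝ} (r : ℝ) : OrderGE g (HahnSeries.single g r : GPS) :=
  iff_le_orderTop.2 HahnSeries.orderTop_single_le

theorem C (r : ℝ) : OrderGE 0 (HahnSeries.C r : GPS) := single r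

theorem eq_zero {x : GPS} (h : ∀ k : ℕ, ∃ g : ℝ, (k : ℝ) ≤ g ∧ OrderGE g x) : x = 0 := by
  ext a
  obtain ⟨k, hk⟩ := exists_nat_gt a
  obtain ⟨g, hg, hx⟩ := h k
  exact hx a (hk.trans_le hg)

end OrderGE

/-- A sequence of series whose consecutive differences have linearly growing order converges. -/
theorem exists_limit {δ : ℝ} (hδ : 0 < δ) (x : ℕ → GPS)
    (h : ∀ k : ℕ, OrderGE ((k + 1) * δ) (x (k + 1) - x k)) :
    ∃ X : GPS, ∀ k : ℕ, OrderGE ((k + 1) * δ) (X - x k) := by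
  have hstep : ∀ (k d : ℕ) (a : ℝ), a < (k + 1) * δ → (x (k + d)).coeff a = (x k).coeff a := by
    intro k d
    induction d with
    | zero => intro a _; rfl
    | succ d ih =>
      intro a ha
      have h1 := h (k + d) a (ha.trans_le (by push_cast; gcongr; simp))
      rw [HahnSeries.coeff_sub, sub_eq_zero] at h1
      rw [← add_assoc, h1, ih a ha]
  have hceil : ∀ a : ℝ, a < ((⌈a / δ⌉₊ : ℝ) + 1) * δ := by
    intro a
    have h1 := Nat.le_ceil (a / δ)
    rw [div_le_iff₀ hδ] at h1
    nlinarith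
  have hcoeff : ∀ (k : ℕ) (a : ℝ), a < (k + 1) * δ →
      (x ⌈a / δ⌉₊).coeff a = (x k).coeff a := by
    intro k a ha
    rcases le_total k ⌈a / δ⌉₊ with hk | hk
    · obtain ⟨d, hd⟩ := Nat.exists_eq_add_of_le hk
      rw [hd]; exact hstep k d a ha
    · obtain ⟨d, hd⟩ := Nat.exists_eq_add_of_le hk
      have := hstep ⌈a / δ⌉₊ d a (hceil a)
      rw [← this, ← hd]
  refine ⟨⟨fun a => (x ⌈a / δ⌉₊).coeff a, ?_⟩, ?_⟩
  · rw [Set.isPWO_iff_isWF, Set.isWF_iff_no_descending_seq]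
    intro f hf hmem
    have hPWO := (x ⌈f 0 / δ⌉₊).isPWO_support
    rw [Set.isPWO_iff_isWF, Set.isWF_iff_no_descending_seq] at hPWO
    refine hPWO f hf fun k => ?_
    have h1 := hcoeff ⌈f 0 / δ⌉₊ (f k) ((hf.antitone (Nat.zero_le k)).trans_lt (hceil (f 0)))
    have h2 := hmem k
    rw [Function.mem_support, h1] at h2
    exact h2
  · intro k a ha
    rw [HahnSeries.coeff_sub, sub_eq_zero]
    exact hcoeff k a ha

/-- Fixed points of contractions of a ball in a power of the field of generalized Puiseux
series. -/
theorem exists_fixedPoint {ι : Type*} {δ : ℝ} (hδ : 0 < δ) (Φ : (ι → GPS) → ι → GPS)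
    (h0 : ∀ v, OrderGE δ (Φ 0 v))
    (hΦ : ∀ (η η' : ι → GPS) (g : ℝ), (∀ v, OrderGE δ (η v)) → (∀ v, OrderGE δ (η' v)) →
      (∀ v, OrderGE g (η v - η' v)) → ∀ v, OrderGE (g + δ) (Φ η v - Φ η' v)) :
    ∃ η : ι → GPS, (∀ v, OrderGE δ (η v)) ∧ Φ η = η := by
  have hball : ∀ η : ι → GPS, (∀ v, OrderGE δ (η v)) → ∀ v, OrderGE δ (Φ η v) := by
    intro η hη v
    have h1 := hΦ η 0 δ hη (fun _ => .zero _) (by simpa using hη) v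
    have h2 := (h1.mono (by linarith : δ ≤ δ + δ)).add (h0 v)
    simpa using h2
  let x : ℕ → ι → GPS := fun k => Φ^[k] 0
  have hx : ∀ k, x (k + 1) = Φ (x k) := fun k => Function.iterate_succ_apply' Φ k 0
  have hxδ : ∀ k v, OrderGE δ (x k v) := by
    intro k
    induction k with
    | zero => exact fun _ => .zero _
    | succ k ih => rw [hx]; exact hball _ ih
  have hdiff : ∀ (k : ℕ) v, OrderGE ((k + 1) * δ) (x (k + 1) v - x k v) := by
    intro k
    induction k with
    | zero =>
      intro v
      have := hxδ 1 v
      simpa [x] using this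
    | succ k ih =>
      intro v
      rw [hx (k + 1), hx k]
      have := hΦ (x (k + 1)) (x k) _ (hxδ _) (hxδ _) ih v
      rw [← hx k] at this ⊢
      refine this.mono (le_of_eq ?_)
      push_cast
      ring
  choose η hη using fun v => exists_limit hδ (fun k => x k v) (fun k => hdiff k v)
  have hηδ : ∀ v, OrderGE δ (η v) := by
    intro v
    have := hη v 0
    simpa [x] using this
  refine ⟨η, hηδ, funext fun v => sub_eq_zero.1 (OrderGE.eq_zero fun k => ?_)⟩
  obtain ⟨l, hl⟩ := exists_nat_gt (k / δ)
  rw [div_lt_iff₀ hδ] at hl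
  refine ⟨(l + 1) * δ, by nlinarith, ?_⟩
  have h1 := (hΦ η (x l) _ hηδ (hxδ l) (fun v => hη v l) v).mono
    (by linarith : ((l : ℝ) + 1) * δ ≤ _)
  have h2 := (hη v (l + 1)).mono (by push_cast; nlinarith : ((l : ℝ) + 1) * δ ≤ _)
  have h3 := h1.sub h2
  rw [← hx l] at h3
  simpa using h3

/-- The series `x` is positive of valuation `g`. -/
def PosVal (g : ℝ) (x : GPS) : Prop := 0 < x.coeff g ∧ OrderGE g x

namespace PosVal

theorem ne_zero {g : ℝ} {x : GPS} (h : PosVal g x) : x ≠ 0 := by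
  rintro rfl
  exact absurd h.1 (by simp)

theorem order_eq {g : ℝ} {x : GPS} (h : PosVal g x) : x.order = g := by
  refine le_antisymm (HahnSeries.order_le_of_coeff_ne_zero h.1.ne') ?_
  by_contra! hlt
  exact h.ne_zero (HahnSeries.coeff_order_eq_zero.1 (h.2 _ hlt))

theorem iff_order {g : ℝ} {x : GPS} :
    PosVal g x ↔ x.order = g ∧ 0 < x.leadingCoeff := by
  constructor
  · intro h
    refine ⟨h.order_eq, ?_⟩
    rw [HahnSeries.leadingCoeff_eq, h.order_eq]
    exact h.1
  · rintro ⟨rfl, h⟩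
    rw [HahnSeries.leadingCoeff_eq] at h
    exact ⟨h, fun a ha => HahnSeries.coeff_eq_zero_of_lt_order ha⟩

theorem mul {g g' : ℝ} {x y : GPS} (hx : PosVal g x) (hy : PosVal g' y) :
    PosVal (g + g') (x * y) := by
  have h1 := iff_order.1 hx
  have h2 := iff_order.1 hy
  rw [iff_order, HahnSeries.order_mul hx.ne_zero hy.ne_zero, HahnSeries.leadingCoeff_mul, h1.1, h2.1]
  exact ⟨rfl, mul_pos h1.2 h2.2⟩

theorem one : PosVal 0 1 := by
  rw [iff_order]; simp

theorem inv {g : ℝ} {x : GPS} (hx : PosVal g x) : PosVal (-g) x⁻¹ := by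
  have h1 := iff_order.1 hx
  have h2 : x * x⁻¹ = 1 := mul_inv_cancel₀ hx.ne_zero
  have h3 := HahnSeries.order_mul hx.ne_zero (inv_ne_zero hx.ne_zero)
  have h4 := HahnSeries.leadingCoeff_mul x x⁻¹
  rw [h2] at h3 h4
  rw [HahnSeries.order_one, h1.1] at h3
  rw [HahnSeries.leadingCoeff_one] at h4
  refine iff_order.2 ⟨by linarith, ?_⟩
  exact pos_of_mul_pos_right (h4 ▸ one_pos) h1.2.le

theorem div {g g' : ℝ} {x y : GPS} (hx : PosVal g x) (hy : PosVal g' y) :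
    PosVal (g - g') (x / y) := by
  rw [div_eq_mul_inv, sub_eq_add_neg]
  exact hx.mul hy.inv

theorem congr {g g' : ℝ} {x : GPS} (h : PosVal g x) (e : g = g') : PosVal g' x := e ▸ h

theorem coeff_nonneg {g g' : ℝ} {x : GPS} (h : PosVal g x) (hg : g' ≤ g) : 0 ≤ x.coeff g' := by
  rcases hg.eq_or_lt with rfl | hlt
  · exact h.1.le
  · exact (h.2 _ hlt).ge

theorem add {g g' : ℝ} {x y : GPS} (hx : PosVal g x) (hy : PosVal g' y) :
    PosVal (min g g') (x + y) := by
  refine ⟨?_, (hx.2.mono (min_le_left _ _)).add (hy.2.mono (min_le_right _ _))⟩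
  rw [HahnSeries.coeff_add]
  rcases le_total g g' with h | h
  · rw [min_eq_left h]
    exact add_pos_of_pos_of_nonneg hx.1 (hy.coeff_nonneg h)
  · rw [min_eq_right h]
    exact add_pos_of_nonneg_of_pos (hx.coeff_nonneg h) hy.1

theorem single {g r : ℝ} (hr : 0 < r) : PosVal g (HahnSeries.single g r : GPS) :=
  ⟨by simpa using hr, .single r⟩

theorem one_add {δ : ℝ} (hδ : 0 < δ) {x : GPS} (hx : OrderGE δ x) : PosVal 0 (1 + x) := by
  refine ⟨?_, one.2.add (hx.mono hδ.le)⟩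
  rw [HahnSeries.coeff_add, hx 0 hδ, add_zero]
  exact one.1

end PosVal

section Quiver

variable {V : Type*} [DecidableEq V] {D : Finset V} {out inn : V → Finset V} {ρ : V → ℕ}

/-- A vertex-balanced positive real labelling of a graded quiver, normalized to be one at the
vertices outside `D`. -/
theorem exists_real_balanced
    (hout : ∀ v ∈ D, ∀ w ∈ out v, ρ w = ρ v + 1) (hin : ∀ v ∈ D, ∀ u ∈ inn v, ρ u + 1 = ρ v)
    (hout' : ∀ v ∈ D, (out v).Nonempty) (hin' : ∀ v ∈ D, (inn v).Nonempty) :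
    ∃ y : V → ℝ, (∀ v, 0 < y v) ∧
      ∀ v ∈ D, ∑ w ∈ out v, y w / y v = ∑ u ∈ inn v, y v / y u := by
  classical
  obtain ⟨R, hR⟩ : ∃ R : ℕ, ∀ v ∈ D, ρ v + 1 ≤ R :=
    ⟨D.sup fun v => ρ v + 1, fun v hv => Finset.le_sup (f := fun v => ρ v + 1) hv⟩
  obtain ⟨C, hC⟩ : ∃ C : ℕ, ∀ v ∈ D, (out v).card ≤ C ∧ (inn v).card ≤ C :=
    ⟨D.sup fun v => max (out v).card (inn v).card, fun v hv => max_le_iff.1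
      (Finset.le_sup (f := fun v => max (out v).card (inn v).card) hv)⟩
  let e : V → ℝ := fun v => C * ((R : ℝ) ^ 2 - (ρ v : ℝ) ^ 2)
  have he : ∀ v, ρ v ≤ R → 0 ≤ e v := fun v hv =>
    mul_nonneg C.cast_nonneg (sub_nonneg.2 (by gcongr))
  let b : V → ℝ := fun v => if v ∈ D then Real.exp (e v) else 1
  have hb1 : ∀ v, 1 ≤ b v := by
    intro v
    by_cases hv : v ∈ D
    · simpa [b, hv] using he v (by have := hR v hv; omega)
    · simp [b, hv]
  have hbe : ∀ v, ρ v ≤ R → b v ≤ Real.exp (e v) := by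
    intro v hv
    by_cases hv' : v ∈ D
    · simp [b, hv']
    · simpa [b, hv'] using he v hv
  have hbpos : ∀ v, 0 < b v := fun v => one_pos.trans_le (hb1 v)
  have hCexp : (C : ℝ) ≤ Real.exp (2 * C) := by
    have := Real.add_one_le_exp (2 * (C : ℝ))
    have := (Nat.cast_nonneg C : (0 : ℝ) ≤ C)
    linarith
  let N : (V → ℝ) → V → ℝ := fun y v => ∑ w ∈ out v, y w
  let M : (V → ℝ) → V → ℝ := fun y v => ∑ u ∈ inn v, (y u)⁻¹
  let T : (V → ℝ) → V → ℝ := fun y v => if v ∈ D then √(N y v / M y v) else 1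
  have hNpos : ∀ y : V → ℝ, (∀ v, 0 < y v) → ∀ v ∈ D, 0 < N y v := fun y hy v hv =>
    Finset.sum_pos (fun w _ => hy w) (hout' v hv)
  have hMpos : ∀ y : V → ℝ, (∀ v, 0 < y v) → ∀ v ∈ D, 0 < M y v := fun y hy v hv =>
    Finset.sum_pos (fun w _ => inv_pos.2 (hy w)) (hin' v hv)
  have hTmono : ∀ y z : V → ℝ, (∀ v, 0 < y v) → (∀ v, y v ≤ z v) → ∀ v, T y v ≤ T z v := by
    intro y z hy hyz v
    by_cases hv : v ∈ D
    · simp only [T, hv, if_true]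
      refine Real.sqrt_le_sqrt ?_
      have hz : ∀ v, 0 < z v := fun v => (hy v).trans_le (hyz v)
      have h1 : M z v ≤ M y v := Finset.sum_le_sum fun u _ => inv_anti₀ (hy u) (hyz u)
      have h2 : N y v ≤ N z v := Finset.sum_le_sum fun u _ => hyz u
      exact div_le_div₀ (hNpos z hz v hv).le h2 (hMpos z hz v hv) h1
    · simp [T, hv]
  have key : ∀ v ∈ D, ∀ w ∈ out v, ∀ u ∈ inn v,
      C * Real.exp (e w) * Real.exp (e u) ≤ b v ^ 2 := by
    intro v hv w hw u hu
    have h1 : (ρ w : ℝ) = ρ v + 1 := by exact_mod_cast hout v hv w hw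
    have h2 : (ρ u : ℝ) = ρ v - 1 := by
      have : (ρ u : ℝ) + 1 = ρ v := by exact_mod_cast hin v hv u hu
      linarith
    calc C * Real.exp (e w) * Real.exp (e u)
        ≤ Real.exp (2 * C) * Real.exp (e w) * Real.exp (e u) := by gcongr
      _ = b v ^ 2 := by
        simp only [b, hv, if_true, e]
        rw [← Real.exp_add, ← Real.exp_add, ← Real.exp_nat_mul, h1, h2]
        congr 1
        push_cast
        ring
  have hwR : ∀ v ∈ D, ∀ w ∈ out v, ρ w ≤ R := fun v hv w hw => by
    rw [hout v hv w hw]; exact hR v hv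
  have huR : ∀ v ∈ D, ∀ u ∈ inn v, ρ u ≤ R := fun v hv u hu => by
    have := hR v hv; have := hin v hv u hu; omega
  have hTb : ∀ v, T b v ≤ b v := by
    intro v
    by_cases hv : v ∈ D
    · simp only [T, hv, if_true]
      rw [Real.sqrt_le_left (hbpos v).le, div_le_iff₀ (hMpos b hbpos v hv)]
      obtain ⟨u, hu⟩ := hin' v hv
      obtain ⟨w₀, hw₀⟩ := hout' v hv
      have h1 : N b v ≤ C * Real.exp (e w₀) := by
        refine (Finset.sum_le_card_nsmul (out v) b (Real.exp (e w₀)) fun w hw => ?_).trans ?_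
        · refine (hbe w (hwR v hv w hw)).trans (le_of_eq ?_)
          simp only [e, hout v hv w hw, hout v hv w₀ hw₀]
        · rw [nsmul_eq_mul]
          gcongr
          exact (hC v hv).1
      have h2 : (Real.exp (e u))⁻¹ ≤ M b v :=
        (inv_anti₀ (hbpos u) (hbe u (huR v hv u hu))).trans
          (Finset.single_le_sum (f := fun u => (b u)⁻¹) (fun w _ => (inv_pos.2 (hbpos w)).le) hu)
      have h3 := key v hv w₀ hw₀ u hu
      have h4 : C * Real.exp (e w₀) ≤ b v ^ 2 * (Real.exp (e u))⁻¹ := by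
        rwa [← div_eq_mul_inv, le_div_iff₀ (Real.exp_pos _)]
      exact h1.trans (h4.trans (by gcongr))
    · simp [T, hv, b]
  have hTb' : ∀ v, (b v)⁻¹ ≤ T (fun v => (b v)⁻¹) v := by
    intro v
    have hbi : ∀ v, 0 < (b v)⁻¹ := fun v => inv_pos.2 (hbpos v)
    by_cases hv : v ∈ D
    · simp only [T, hv, if_true]
      refine Real.le_sqrt_of_sq_le ?_
      rw [le_div_iff₀ (hMpos _ hbi v hv)]
      obtain ⟨u₀, hu₀⟩ := hin' v hv
      obtain ⟨w, hw⟩ := hout' v hv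
      have h1 : M (fun v => (b v)⁻¹) v ≤ C * Real.exp (e u₀) := by
        refine (Finset.sum_le_card_nsmul (inn v) (fun u => ((b u)⁻¹)⁻¹) (Real.exp (e u₀))
          fun u hu => ?_).trans ?_
        · rw [inv_inv]
          refine (hbe u (huR v hv u hu)).trans (le_of_eq ?_)
          have h1 := hin v hv u hu
          have h2 := hin v hv u₀ hu₀
          have h3 : ρ u = ρ u₀ := by omega
          simp only [e, h3]
        · rw [nsmul_eq_mul]
          gcongr
          exact (hC v hv).2
      have h2 : (Real.exp (e w))⁻¹ ≤ N (fun v => (b v)⁻¹) v :=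
        (inv_anti₀ (hbpos w) (hbe w (hwR v hv w hw))).trans
          (Finset.single_le_sum (f := fun u => (b u)⁻¹) (fun w _ => (inv_pos.2 (hbpos w)).le) hw)
      have h3 := key v hv w hw u₀ hu₀
      refine le_trans ?_ h2
      have h5 : (b v)⁻¹ ^ 2 * M (fun v => (b v)⁻¹) v ≤ (b v)⁻¹ ^ 2 * (C * Real.exp (e u₀)) := by
        gcongr
      refine h5.trans ?_
      rw [inv_pow, inv_mul_le_iff₀ (by have := hbpos v; positivity), ← div_eq_mul_inv,
        le_div_iff₀ (Real.exp_pos _)]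
      linarith
    · simp [T, hv, b]
  let S : Set (V → ℝ) := {y | (∀ v, (b v)⁻¹ ≤ y v) ∧ (∀ v, y v ≤ b v) ∧ ∀ v, y v ≤ T y v}
  have hbS : (fun v => (b v)⁻¹) ∈ S :=
    ⟨fun v => le_rfl, fun v => (inv_le_one_of_one_le₀ (hb1 v)).trans (hb1 v), hTb'⟩
  let Y : V → ℝ := fun v => ⨆ y : S, (y : V → ℝ) v
  have : Nonempty S := ⟨⟨_, hbS⟩⟩
  have hbdd : ∀ v, BddAbove (Set.range fun y : S => (y : V → ℝ) v) := by
    intro v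
    refine ⟨b v, ?_⟩
    rintro _ ⟨y, rfl⟩
    exact y.2.2.1 v
  have hleY : ∀ y ∈ S, ∀ v, y v ≤ Y v := fun y hy v => le_ciSup (hbdd v) (⟨y, hy⟩ : S)
  have hYb : ∀ v, (b v)⁻¹ ≤ Y v := hleY _ hbS
  have hYb' : ∀ v, Y v ≤ b v := fun v => ciSup_le fun y => y.2.2.1 v
  have hposS : ∀ y : V → ℝ, (∀ v, (b v)⁻¹ ≤ y v) → ∀ v, 0 < y v := fun y hy v =>
    (inv_pos.2 (hbpos v)).trans_le (hy v)
  have hYpos := hposS Y hYb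
  have hYT : ∀ v, Y v ≤ T Y v := fun v => ciSup_le fun y =>
    (y.2.2.2 v).trans (hTmono y Y (hposS y y.2.1) (hleY y y.2) v)
  have hTYS : T Y ∈ S := by
    refine ⟨fun v => (hYb v).trans (hYT v), fun v => ?_, hTmono _ _ hYpos hYT⟩
    exact (hTmono Y b hYpos hYb' v).trans (hTb v)
  have hfix : ∀ v, Y v = T Y v := fun v => le_antisymm (hYT v) (hleY _ hTYS v)
  refine ⟨Y, hYpos, fun v hv => ?_⟩
  have h1 := hfix v
  simp only [T, hv, if_true] at h1
  have h2 : Y v ^ 2 = N Y v / M Y v := by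
    rw [h1, Real.sq_sqrt (div_pos (hNpos Y hYpos v hv) (hMpos Y hYpos v hv)).le]
  rw [eq_div_iff (hMpos Y hYpos v hv).ne'] at h2
  have h3 := (hYpos v).ne'
  rw [← Finset.sum_div, div_eq_iff h3]
  simp only [div_eq_mul_inv]
  rw [← Finset.mul_sum]
  change N Y v = Y v * M Y v * Y v
  rw [← h2]; ring

/-- Maximum principle for weighted averages on a graded quiver. -/
theorem nonpos_of_harmonic {a b : V → V → ℝ}
    (hout : ∀ v ∈ D, ∀ w ∈ out v, ρ w = ρ v + 1)
    (hout' : ∀ v ∈ D, (out v).Nonempty)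
    (ha : ∀ v ∈ D, ∀ w ∈ out v, 0 < a v w) (hb : ∀ v ∈ D, ∀ u ∈ inn v, 0 < b v u)
    (η : V → ℝ) (hη : ∀ v, v ∉ D → η v = 0)
    (hbal : ∀ v ∈ D, ∑ w ∈ out v, a v w * (η w - η v) - ∑ u ∈ inn v, b v u * (η v - η u) = 0)
    (v : V) : η v ≤ 0 := by
  by_contra! hpos
  have hvD : v ∈ D := by
    by_contra h
    exact hpos.ne' (hη v h)
  obtain ⟨m, hmD, hm⟩ := D.exists_max_image η ⟨v, hvD⟩
  have hmpos : 0 < η m := hpos.trans_le (hm v hvD)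
  have hle : ∀ w, η w ≤ η m := by
    intro w
    by_cases hw : w ∈ D
    · exact hm w hw
    · rw [hη w hw]; exact hmpos.le
  obtain ⟨x, hx, hxmax⟩ := (D.filter fun w => η w = η m).exists_max_image ρ
    ⟨m, Finset.mem_filter.2 ⟨hmD, rfl⟩⟩
  rw [Finset.mem_filter] at hx
  obtain ⟨hxD, hxm⟩ := hx
  have h1 : ∀ w ∈ out x, a x w * (η w - η x) ≤ 0 := fun w hw =>
    mul_nonpos_of_nonneg_of_nonpos (ha x hxD w hw).le (by rw [hxm]; linarith [hle w])
  have h2 : 0 ≤ ∑ u ∈ inn x, b x u * (η x - η u) := Finset.sum_nonneg fun u hu =>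
    mul_nonneg (hb x hxD u hu).le (by rw [hxm]; linarith [hle u])
  have h3 : ∑ w ∈ out x, a x w * (η w - η x) = 0 :=
    le_antisymm (Finset.sum_nonpos h1) (by linarith [hbal x hxD])
  rw [Finset.sum_eq_zero_iff_of_nonpos h1] at h3
  obtain ⟨w, hw⟩ := hout' x hxD
  have h4 : η w = η m := by
    have := (mul_eq_zero.1 (h3 w hw)).resolve_left (ha x hxD w hw).ne'
    linarith
  have hwD : w ∈ D := by
    by_contra h
    exact hmpos.ne' (h4 ▸ hη w h)
  have := hxmax w (Finset.mem_filter.2 ⟨hwD, h4⟩)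
  have := hout x hxD w hw
  omega

/-- The Dirichlet problem on a graded quiver: the weighted Laplacian, restricted to functions
vanishing outside `D`, has an inverse with real entries over the generalized Puiseux series. -/
theorem exists_green {a b : V → V → ℝ}
    (hout : ∀ v ∈ D, ∀ w ∈ out v, ρ w = ρ v + 1)
    (hout' : ∀ v ∈ D, (out v).Nonempty)
    (ha : ∀ v ∈ D, ∀ w ∈ out v, 0 < a v w) (hb : ∀ v ∈ D, ∀ u ∈ inn v, 0 < b v u) :
    ∃ G : V → V → ℝ,
      (∀ η : V → GPS, (∀ v, v ∉ D → η v = 0) → ∀ v ∈ D,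
        ∑ x ∈ D, HahnSeries.C (G v x) * (∑ w ∈ out x, HahnSeries.C (a x w) * (η w - η x) -
          ∑ u ∈ inn x, HahnSeries.C (b x u) * (η x - η u)) = η v) ∧
      (∀ f : V → GPS, (∀ v ∈ D, ∑ x ∈ D, HahnSeries.C (G v x) * f x = 0) → ∀ v ∈ D, f v = 0) := by
  classical
  let δ : V → V → ℝ := fun v x => if v = x then 1 else 0
  let J : Matrix D D ℝ := fun v x => ∑ w ∈ out v, a v w * (δ w x - δ v x) -
    ∑ u ∈ inn v, b v u * (δ v x - δ u x)
  have hJ : ∀ {A : Type} [CommRing A] (f : ℝ →+* A) (η : V → A), (∀ v, v ∉ D → η v = 0) →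
      ∀ v : D, ∑ x : D, f (J v x) * η x = ∑ w ∈ out v, f (a v w) * (η w - η v) -
        ∑ u ∈ inn v, f (b v u) * (η v - η u) := by
    intro A _ f η hη v
    have hδ : ∀ w, ∑ x : D, f (δ w x) * η x = η w := by
      intro w
      rw [Finset.sum_coe_sort D (fun x => f (δ w x) * η x)]
      by_cases hw : w ∈ D
      · rw [Finset.sum_eq_single w]
        · simp [δ]
        · intro x _ hx
          simp [δ, hx.symm]
        · exact fun h => absurd hw h
      · rw [hη w hw]
        refine Finset.sum_eq_zero fun x hx => ?_
        have : w ≠ x := fun h => hw (h ▸ hx)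
        simp [δ, this]
    simp only [J, map_sub, map_sum, map_mul, sub_mul, Finset.sum_mul, mul_assoc,
      Finset.sum_sub_distrib]
    simp only [mul_sub, Finset.sum_sub_distrib]
    have e1 : ∀ (s : Finset V) (c : V → ℝ) (z : V → V),
        ∑ x : D, ∑ w ∈ s, f (c w) * (f (δ (z w) x) * η x) = ∑ w ∈ s, f (c w) * η (z w) := by
      intro s c z
      rw [Finset.sum_comm]
      refine Finset.sum_congr rfl fun w _ => ?_
      rw [← Finset.mul_sum, hδ]
    rw [e1 (out v) (a v) fun w => w, e1 (out v) (a v) fun _ => v, e1 (inn v) (b v) fun _ => v,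
      e1 (inn v) (b v) fun u => u]
  have hinj : Function.Injective J.mulVec := by
    rw [← Matrix.coe_mulVecLin, injective_iff_map_eq_zero]
    intro ξ hξ
    have hξ' : ∀ v : D, ∑ x : D, J v x * ξ x = 0 := fun v => congrFun hξ v
    let η : V → ℝ := fun v => if h : v ∈ D then ξ ⟨v, h⟩ else 0
    have hη : ∀ v, v ∉ D → η v = 0 := fun v hv => by simp [η, hv]
    have hηξ : ∀ x : D, η x = ξ x := fun x => by simp [η]
    have hbal : ∀ v ∈ D, ∑ w ∈ out v, a v w * (η w - η v) -
        ∑ u ∈ inn v, b v u * (η v - η u) = 0 := by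
      intro v hv
      have h1 := hJ (RingHom.id ℝ) η hη ⟨v, hv⟩
      simp only [RingHom.id_apply, hηξ] at h1
      rw [← h1]
      exact hξ' ⟨v, hv⟩
    have h1 := nonpos_of_harmonic hout hout' ha hb η hη hbal
    have h2 := nonpos_of_harmonic hout hout' ha hb (-η) (fun v hv => by simp [hη v hv])
      (fun v hv => by
        have := hbal v hv
        rw [← neg_eq_zero, neg_sub'] at this
        rw [← this, ← Finset.sum_neg_distrib, ← Finset.sum_neg_distrib]
        congr 1 <;> refine Finset.sum_congr rfl fun w _ => ?_ <;>
          simp only [Pi.neg_apply] <;> ring)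
    ext x
    rw [← hηξ]
    exact le_antisymm (h1 x) (by simpa using h2 x)
  have hunit : IsUnit J := Matrix.mulVec_injective_iff_isUnit.1 hinj
  have hdet : IsUnit J.det := (Matrix.isUnit_iff_isUnit_det J).1 hunit
  let G : V → V → ℝ := fun v x => if h : v ∈ D ∧ x ∈ D then J⁻¹ ⟨v, h.1⟩ ⟨x, h.2⟩ else 0
  have hG : ∀ v x : D, G v x = J⁻¹ v x := fun v x => by simp [G]
  refine ⟨G, ?_, ?_⟩
  · intro η hη v hv
    rw [← Finset.sum_coe_sort D]
    simp only [← hJ HahnSeries.C η hη, Finset.mul_sum, ← mul_assoc, ← map_mul]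
    rw [Finset.sum_comm]
    simp only [← Finset.sum_mul, ← map_sum]
    have h1 : ∀ x : D, ∑ i : D, G v i * J i x = if (⟨v, hv⟩ : D) = x then 1 else 0 := by
      intro x
      have := congrFun (congrFun (Matrix.nonsing_inv_mul J hdet) ⟨v, hv⟩) x
      rw [Matrix.one_apply, Matrix.mul_apply] at this
      rw [← this]
      exact Finset.sum_congr rfl fun i _ => by rw [← hG ⟨v, hv⟩]
    simp only [h1]
    rw [Finset.sum_eq_single ⟨v, hv⟩]
    · simp
    · intro x _ hx
      simp [hx.symm]
    · simp
  · intro f hf v hv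
    have h1 : ∀ x : D, ∑ i : D, J ⟨v, hv⟩ i * G i x = if (⟨v, hv⟩ : D) = x then 1 else 0 := by
      intro x
      have := congrFun (congrFun (Matrix.mul_nonsing_inv J hdet) ⟨v, hv⟩) x
      rw [Matrix.one_apply, Matrix.mul_apply] at this
      rw [← this]
      exact Finset.sum_congr rfl fun i _ => by rw [← hG]
    have h2 : ∑ i : D, HahnSeries.C (J ⟨v, hv⟩ i) * ∑ x : D, HahnSeries.C (G i x) * f x = 0 := by
      refine Finset.sum_eq_zero fun i _ => ?_
      rw [Finset.sum_coe_sort D (fun x => HahnSeries.C (G i x) * f x), hf i i.2, mul_zero]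
    simp only [Finset.mul_sum, ← mul_assoc, ← map_mul] at h2
    rw [Finset.sum_comm] at h2
    simp only [← Finset.sum_mul, ← map_sum, h1] at h2
    rw [Finset.sum_eq_single ⟨v, hv⟩] at h2
    · simpa using h2
    · intro x _ hx
      simp [hx.symm]
    · simp

theorem orderGE_linearize_ratio {δ g : ℝ} (hδ : 0 < δ) {p q p' q' : GPS} (hp : OrderGE δ p)
    (hq : OrderGE δ q) (hq' : OrderGE δ q')
    (hpp : OrderGE g (p - p')) (hqq : OrderGE g (q - q')) :
    OrderGE (g + δ) ((1 + p) / (1 + q) - (1 + p') / (1 + q') - ((p - p') - (q - q'))) := by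
  have h1 := PosVal.one_add hδ hq
  have h2 := PosVal.one_add hδ hq'
  have n1 := h1.ne_zero
  have n2 := h2.ne_zero
  have hinv : OrderGE 0 ((1 + q) * (1 + q'))⁻¹ := by simpa using (h1.mul h2).inv.2
  have e : (1 + p) / (1 + q) - (1 + p') / (1 + q') - ((p - p') - (q - q')) =
      ((p - p') * q - p * (q - q') - ((p - p') - (q - q')) * (q + q' + q * q')) *
        ((1 + q) * (1 + q'))⁻¹ := by
    field_simp
    ring
  rw [e]
  have hqq' : OrderGE δ (q + q' + q * q') :=
    (hq.add hq').add ((hq.mul hq').mono (by linarith))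
  have h3 := ((hpp.mul hq).sub ((hp.mul hqq).mono (by linarith : g + δ ≤ δ + g))).sub
    ((hpp.sub hqq).mul hqq')
  simpa using h3.mul hinv

theorem orderGE_linearize_edge {δ g c r : ℝ} (hδ : 0 < δ) (hc : c = 0 ∨ δ ≤ c) {p q p' q' : GPS}
    (hp : OrderGE δ p) (hq : OrderGE δ q) (hq' : OrderGE δ q')
    (hpp : OrderGE g (p - p')) (hqq : OrderGE g (q - q')) :
    OrderGE (g + δ) (HahnSeries.single c r * ((1 + p) / (1 + q)) -
      HahnSeries.single c r * ((1 + p') / (1 + q')) -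
      if c = 0 then HahnSeries.C r * ((p - p') - (q - q')) else 0) := by
  have h := orderGE_linearize_ratio hδ hp hq hq' hpp hqq
  by_cases h0 : c = 0
  · subst h0
    rw [if_pos rfl]
    have := (OrderGE.C r).mul h
    rw [zero_add] at this
    convert this using 1
    rw [HahnSeries.C_apply]
    ring
  · rw [if_neg h0, sub_zero, ← mul_sub]
    have h1 : OrderGE g ((1 + p) / (1 + q) - (1 + p') / (1 + q')) := by
      have := (h.mono (by linarith : g ≤ g + δ)).add (hpp.sub hqq)
      simpa using this
    exact ((OrderGE.single r).mul h1).mono (by linarith [hc.resolve_left h0])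

end Quiver

/-- A positive balanced labelling of a graded quiver with prescribed valuations: if the valuations
`ν` make the minimal arrow-valuation out of and into each vertex of `D` agree, then `ν` lifts to
a balanced labelling by positive generalized Puiseux series. -/
theorem exists_balanced {V : Type*} [DecidableEq V] {D : Finset V} {out inn : V → Finset V}
    {ρ : V → ℕ} (ν μ : V → ℝ)
    (hout : ∀ v ∈ D, ∀ w ∈ out v, ρ w = ρ v + 1) (hin : ∀ v ∈ D, ∀ u ∈ inn v, ρ u + 1 = ρ v)
    (hνout : ∀ v ∈ D, ∀ w ∈ out v, μ v ≤ ν w - ν v) (hνin : ∀ v ∈ D, ∀ u ∈ inn v, μ v ≤ ν v - ν u)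
    (hνout' : ∀ v ∈ D, ∃ w ∈ out v, ν w - ν v = μ v)
    (hνin' : ∀ v ∈ D, ∃ u ∈ inn v, ν v - ν u = μ v) :
    ∃ x : V → GPS, (∀ v, PosVal (ν v) (x v)) ∧
      ∀ v ∈ D, ∑ w ∈ out v, x w / x v = ∑ u ∈ inn v, x v / x u := by
  classical
  let out' : V → Finset V := fun v => (out v).filter fun w => ν w - ν v - μ v = 0
  let inn' : V → Finset V := fun v => (inn v).filter fun u => ν v - ν u - μ v = 0
  have hsub : ∀ v, out' v ⊆ out v := fun v => Finset.filter_subset _ _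
  have hsub' : ∀ v, inn' v ⊆ inn v := fun v => Finset.filter_subset _ _
  have hout1 : ∀ v ∈ D, ∀ w ∈ out' v, ρ w = ρ v + 1 := fun v hv w hw => hout v hv w (hsub v hw)
  have hin1 : ∀ v ∈ D, ∀ u ∈ inn' v, ρ u + 1 = ρ v := fun v hv u hu => hin v hv u (hsub' v hu)
  have hout2 : ∀ v ∈ D, (out' v).Nonempty := fun v hv => by
    obtain ⟨w, hw, h⟩ := hνout' v hv
    exact ⟨w, Finset.mem_filter.2 ⟨hw, by linarith⟩⟩
  have hin2 : ∀ v ∈ D, (inn' v).Nonempty := fun v hv => by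
    obtain ⟨w, hw, h⟩ := hνin' v hv
    exact ⟨w, Finset.mem_filter.2 ⟨hw, by linarith⟩⟩
  obtain ⟨y, hy, hybal⟩ := exists_real_balanced hout1 hin1 hout2 hin2
  obtain ⟨G, hG1, hG2⟩ := exists_green (D := D) (out := out') (inn := inn') (ρ := ρ)
    (a := fun v w => y w / y v) (b := fun v u => y v / y u) hout1 hout2
    (fun v _ w _ => div_pos (hy w) (hy v)) (fun v _ u _ => div_pos (hy v) (hy u))
  obtain ⟨δ, hδ, hδout, hδin⟩ : ∃ δ : ℝ, 0 < δ ∧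
      (∀ v ∈ D, ∀ w ∈ out v, ν w - ν v - μ v = 0 ∨ δ ≤ ν w - ν v - μ v) ∧
      ∀ v ∈ D, ∀ u ∈ inn v, ν v - ν u - μ v = 0 ∨ δ ≤ ν v - ν u - μ v := by
    let s : Finset ℝ := (insert 1 (D.biUnion fun v => ((out v).image fun w => ν w - ν v - μ v) ∪
      ((inn v).image fun u => ν v - ν u - μ v))).filter fun r => 0 < r
    have hs : s.Nonempty := ⟨1, by simp [s]⟩
    refine ⟨s.min' hs, ?_, fun v hv w hw => ?_, fun v hv u hu => ?_⟩
    · exact (Finset.mem_filter.1 (s.min'_mem hs)).2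
    · rcases (sub_nonneg.2 (hνout v hv w hw)).eq_or_lt with h | h
      · exact Or.inl h.symm
      · refine Or.inr (s.min'_le _ (Finset.mem_filter.2 ⟨Finset.mem_insert_of_mem ?_, h⟩))
        exact Finset.mem_biUnion.2 ⟨v, hv, Finset.mem_union_left _
          (Finset.mem_image.2 ⟨w, hw, rfl⟩)⟩
    · rcases (sub_nonneg.2 (hνin v hv u hu)).eq_or_lt with h | h
      · exact Or.inl h.symm
      · refine Or.inr (s.min'_le _ (Finset.mem_filter.2 ⟨Finset.mem_insert_of_mem ?_, h⟩))
        exact Finset.mem_biUnion.2 ⟨v, hv, Finset.mem_union_right _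
          (Finset.mem_image.2 ⟨u, hu, rfl⟩)⟩
  let F : (V → GPS) → V → GPS := fun η v =>
    ∑ w ∈ out v, HahnSeries.single (ν w - ν v - μ v) (y w / y v) * ((1 + η w) / (1 + η v)) -
    ∑ u ∈ inn v, HahnSeries.single (ν v - ν u - μ v) (y v / y u) * ((1 + η v) / (1 + η u))
  let L : (V → GPS) → V → GPS := fun η v =>
    ∑ w ∈ out' v, HahnSeries.C (y w / y v) * (η w - η v) -
    ∑ u ∈ inn' v, HahnSeries.C (y v / y u) * (η v - η u)
  let π : (V → GPS) → V → GPS := fun η v => if v ∈ D then η v else 0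
  have hπ : ∀ η v, v ∉ D → π η v = 0 := fun η v hv => by simp [π, hv]
  have hπD : ∀ η, ∀ v ∈ D, π η v = η v := fun η v hv => by simp [π, hv]
  have hπδ : ∀ η : V → GPS, ∀ g, (∀ v, OrderGE g (η v)) → ∀ v, OrderGE g (π η v) := by
    intro η g h v
    by_cases hv : v ∈ D
    · rw [hπD η v hv]; exact h v
    · rw [hπ η v hv]; exact .zero g
  let Φ : (V → GPS) → V → GPS := fun η v =>
    if v ∈ D then π η v - ∑ u ∈ D, HahnSeries.C (G v u) * F (π η) u else 0
  have hlin : ∀ η η' : V → GPS, ∀ g, (∀ v, OrderGE δ (η v)) → (∀ v, OrderGE δ (η' v)) →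
      (∀ v, OrderGE g (η v - η' v)) → ∀ v ∈ D, OrderGE (g + δ) (F η v - F η' v - L (η - η') v) := by
    intro η η' g h1 h2 h3 v hv
    have e : F η v - F η' v - L (η - η') v =
        ∑ w ∈ out v, (HahnSeries.single (ν w - ν v - μ v) (y w / y v) * ((1 + η w) / (1 + η v)) -
          HahnSeries.single (ν w - ν v - μ v) (y w / y v) * ((1 + η' w) / (1 + η' v)) -
          if ν w - ν v - μ v = 0 then
            HahnSeries.C (y w / y v) * ((η w - η' w) - (η v - η' v)) else 0) -
        ∑ u ∈ inn v, (HahnSeries.single (ν v - ν u - μ v) (y v / y u) * ((1 + η v) / (1 + η u)) -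
          HahnSeries.single (ν v - ν u - μ v) (y v / y u) * ((1 + η' v) / (1 + η' u)) -
          if ν v - ν u - μ v = 0 then
            HahnSeries.C (y v / y u) * ((η v - η' v) - (η u - η' u)) else 0) := by
      simp only [F, L, out', inn', Finset.sum_sub_distrib, Finset.sum_filter, Pi.sub_apply]
      abel
    rw [e]
    refine (OrderGE.sum fun w hw => ?_).sub (OrderGE.sum fun u hu => ?_)
    · exact orderGE_linearize_edge hδ (hδout v hv w hw) (h1 w) (h1 v) (h2 v) (h3 w) (h3 v)
    · exact orderGE_linearize_edge hδ (hδin v hv u hu) (h1 v) (h1 u) (h2 u) (h3 v) (h3 u)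
  have hF0 : ∀ v ∈ D, OrderGE δ (F 0 v) := by
    intro v hv
    have h0 : F 0 v = ∑ w ∈ (out v).filter (fun w => ¬ (ν w - ν v - μ v = 0)),
          HahnSeries.single (ν w - ν v - μ v) (y w / y v) -
        ∑ u ∈ (inn v).filter (fun u => ¬ (ν v - ν u - μ v = 0)),
          HahnSeries.single (ν v - ν u - μ v) (y v / y u) := by
      have e1 : ∑ w ∈ out' v, (HahnSeries.single (ν w - ν v - μ v) (y w / y v) : GPS) =
          HahnSeries.C (∑ w ∈ out' v, y w / y v) := by
        rw [map_sum]
        refine Finset.sum_congr rfl fun w hw => ?_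
        rw [(Finset.mem_filter.1 hw).2]; rfl
      have e2 : ∑ u ∈ inn' v, (HahnSeries.single (ν v - ν u - μ v) (y v / y u) : GPS) =
          HahnSeries.C (∑ u ∈ inn' v, y v / y u) := by
        rw [map_sum]
        refine Finset.sum_congr rfl fun w hw => ?_
        rw [(Finset.mem_filter.1 hw).2]; rfl
      simp only [F, Pi.zero_apply, add_zero, div_one, mul_one]
      rw [← Finset.sum_filter_add_sum_filter_not (out v) (fun w => ν w - ν v - μ v = 0),
        ← Finset.sum_filter_add_sum_filter_not (inn v) (fun u => ν v - ν u - μ v = 0)]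
      rw [e1, e2, hybal v hv]
      abel
    rw [h0]
    refine (OrderGE.sum fun w hw => ?_).sub (OrderGE.sum fun u hu => ?_)
    · rw [Finset.mem_filter] at hw
      exact (OrderGE.single _).mono ((hδout v hv w hw.1).resolve_left hw.2)
    · rw [Finset.mem_filter] at hu
      exact (OrderGE.single _).mono ((hδin v hv u hu.1).resolve_left hu.2)
  have hCsum : ∀ (v : V) (f : V → GPS) (g : ℝ), (∀ u ∈ D, OrderGE g (f u)) →
      OrderGE g (∑ u ∈ D, HahnSeries.C (G v u) * f u) := by
    intro v f g hf
    refine OrderGE.sum fun u hu => ?_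
    have := (OrderGE.C (G v u)).mul (hf u hu)
    rwa [zero_add] at this
  have hΦ0 : ∀ v, OrderGE δ (Φ 0 v) := by
    intro v
    by_cases hv : v ∈ D
    · have hπ0 : π 0 = 0 := by ext1 v; simp [π]
      simp only [Φ, hv, if_true, hπ0]
      exact (OrderGE.zero δ).sub (hCsum v _ δ hF0)
    · simp only [Φ, hv, if_false]
      exact .zero δ
  obtain ⟨η, hη, hfix⟩ := exists_fixedPoint hδ Φ hΦ0 (by
    intro η η' g h1 h2 h3 v
    by_cases hv : v ∈ D
    · have h3' : ∀ v, OrderGE g (π η v - π η' v) := by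
        intro v
        by_cases hv : v ∈ D
        · rw [hπD _ v hv, hπD _ v hv]; exact h3 v
        · rw [hπ _ v hv, hπ _ v hv, sub_zero]; exact .zero g
      have h4 := hG1 (π η - π η') (fun v hv => by simp [hπ _ v hv]) v hv
      have e : Φ η v - Φ η' v = -∑ u ∈ D, HahnSeries.C (G v u) *
          (F (π η) u - F (π η') u - L (π η - π η') u) := by
        simp only [Φ, hv, if_true, mul_sub, Finset.sum_sub_distrib]
        have h5 : ∑ u ∈ D, HahnSeries.C (G v u) * L (π η - π η') u = π η v - π η' v := h4
        rw [h5]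
        abel
      rw [e]
      exact (hCsum v _ _ (hlin _ _ g (hπδ η δ h1) (hπδ η' δ h2) h3')).neg
    · simp only [Φ, hv, if_false, sub_zero]
      exact .zero _)
  have hηD : ∀ v, v ∉ D → η v = 0 := by
    intro v hv
    rw [← congrFun hfix v]
    simp [Φ, hv]
  have hπη : π η = η := by
    ext1 v
    by_cases hv : v ∈ D
    · exact hπD η v hv
    · rw [hπ η v hv, hηD v hv]
  have hF : ∀ v ∈ D, F η v = 0 := by
    refine hG2 (F η) fun v hv => ?_
    have := congrFun hfix v
    simp only [Φ, hv, if_true, hπη] at this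
    simpa using this
  have h1η : ∀ v, PosVal 0 (1 + η v) := fun v => PosVal.one_add hδ (hη v)
  let x : V → GPS := fun v => HahnSeries.single (ν v) (y v) * (1 + η v)
  have hratio : ∀ v w, ∀ r : ℝ, x w / x v = HahnSeries.single r 1 *
      (HahnSeries.single (ν w - ν v - r) (y w / y v) * ((1 + η w) / (1 + η v))) := by
    intro v w r
    have n1 := (h1η v).ne_zero
    have n2 : (HahnSeries.single (ν v) (y v) : GPS) ≠ 0 := (PosVal.single (hy v)).ne_zero
    have e : (HahnSeries.single (ν w) (y w) : GPS) = HahnSeries.single r 1 *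
        HahnSeries.single (ν w - ν v - r) (y w / y v) * HahnSeries.single (ν v) (y v) := by
      rw [HahnSeries.single_mul_single, HahnSeries.single_mul_single]
      congr 1
      · congr 1; ring
      · have := (hy v).ne'
        field_simp
    simp only [x]
    rw [e]
    field_simp
  refine ⟨x, fun v => ?_, fun v hv => ?_⟩
  · simpa using (PosVal.single (g := ν v) (hy v)).mul (h1η v)
  · have h := hF v hv
    simp only [F] at h
    rw [sub_eq_zero] at h
    rw [Finset.sum_congr rfl fun w _ => hratio v w (μ v),
      Finset.sum_congr rfl fun u _ => hratio u v (μ v), ← Finset.mul_sum, ← Finset.mul_sum, h]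

/-- The ideal filling with first off-diagonal `c`: its entry `(a, b)` is the maximum of `c` over
the interval `[a, b)`. -/
noncomputable def filling (c : ℕ → NNReal) (a b : ℕ) : ℝ := ((Finset.Ico a b).sup c : NNReal)

namespace filling

variable {c : ℕ → NNReal}

theorem mono {a a' b b' : ℕ} (ha : a' ≤ a) (hb : b ≤ b') : filling c a b ≤ filling c a' b' :=
  NNReal.coe_le_coe.2 (Finset.sup_mono (Finset.Ico_subset_Ico ha hb))

theorem succ_self (a : ℕ) : filling c a (a + 1) = c a := by simp [filling]

theorem split {a b d : ℕ} (hab : a ≤ b) (hbd : b ≤ d) :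
    filling c a d = max (filling c a b) (filling c b d) := by
  unfold filling
  rw [← NNReal.coe_max, ← Finset.Ico_union_Ico_eq_Ico hab hbd, Finset.sup_union]

end filling

/-- The valuation of the chamber variable at `(i, j)`. -/
noncomputable def chamberVal (c : ℕ → NNReal) (n i j : ℕ) : ℝ :=
  ∑ a ∈ Finset.Ico 1 i, filling c a j - ∑ b ∈ Finset.Ico (j + 1) (n + 1), filling c i b

section ChamberVal

variable {c : ℕ → NNReal} {n i j : ℕ}

theorem chamberVal_horizontal (hj : j < n) : chamberVal c n i (j + 1) - chamberVal c n i j =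
    filling c i (j + 1) + ∑ a ∈ Finset.Ico 1 i, (filling c a (j + 1) - filling c a j) := by
  unfold chamberVal
  rw [Finset.sum_eq_sum_Ico_succ_bot (show j + 1 < n + 1 by omega), Finset.sum_sub_distrib]
  ring

theorem chamberVal_vertical (hi : 1 ≤ i) : chamberVal c n (i + 1) j - chamberVal c n i j =
    filling c i j + ∑ b ∈ Finset.Ico (j + 1) (n + 1), (filling c i b - filling c (i + 1) b) := by
  unfold chamberVal
  rw [Finset.sum_Ico_succ_top hi, Finset.sum_sub_distrib]
  ring

theorem filling_le_horizontal :
    filling c i (j + 1) ≤ filling c i (j + 1) +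
      ∑ a ∈ Finset.Ico 1 i, (filling c a (j + 1) - filling c a j) :=
  le_add_of_nonneg_right (Finset.sum_nonneg fun _ _ =>
    sub_nonneg.2 (filling.mono le_rfl (Nat.le_succ j)))

theorem filling_le_vertical :
    filling c i j ≤ filling c i j +
      ∑ b ∈ Finset.Ico (j + 1) (n + 1), (filling c i b - filling c (i + 1) b) :=
  le_add_of_nonneg_right (Finset.sum_nonneg fun _ _ =>
    sub_nonneg.2 (filling.mono (Nat.le_succ i) le_rfl))

theorem horizontal_eq (h : ∀ a, 1 ≤ a → a < i → a ≤ j ∧ (c j : ℝ) ≤ filling c a j) :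
    filling c i (j + 1) + ∑ a ∈ Finset.Ico 1 i, (filling c a (j + 1) - filling c a j) =
      filling c i (j + 1) := by
  rw [Finset.sum_eq_zero, add_zero]
  intro a ha
  rw [Finset.mem_Ico] at ha
  have := h a ha.1 ha.2
  rw [filling.split this.1 (Nat.le_succ j), filling.succ_self, max_eq_left this.2, sub_self]

theorem vertical_eq (h : ∀ b, j < b → b ≤ n → i < b ∧ (c i : ℝ) ≤ filling c (i + 1) b) :
    filling c i j + ∑ b ∈ Finset.Ico (j + 1) (n + 1), (filling c i b - filling c (i + 1) b) =
      filling c i j := by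
  rw [Finset.sum_eq_zero, add_zero]
  intro b hb
  rw [Finset.mem_Ico] at hb
  have := h b (by omega) (by omega)
  rw [filling.split (Nat.le_succ i) this.1, filling.succ_self, max_eq_right this.2, sub_self]

theorem chamberVal_out (hi : 1 ≤ i) (hij : i < j) (hjn : j ≤ n) :
    chamberVal c n (i + 1) j - chamberVal c n i j = filling c i j ∨
      j < n ∧ chamberVal c n i (j + 1) - chamberVal c n i j = filling c i j := by
  rw [chamberVal_vertical hi]
  by_cases hj : j = n
  · exact .inl (vertical_eq fun b _ _ => by omega)
  replace hj : j < n := by omega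
  rw [chamberVal_horizontal hj]
  rcases le_or_gt (c i : ℝ) (filling c (i + 1) (j + 1)) with h | h
  · exact .inl (vertical_eq fun b hb _ => ⟨by omega, h.trans (filling.mono le_rfl hb)⟩)
  · refine .inr ⟨hj, ?_⟩
    have hcj : (c j : ℝ) ≤ filling c (i + 1) (j + 1) := by
      rw [← filling.succ_self]
      exact filling.mono hij le_rfl
    have hc : ∀ a ≤ i, (c j : ℝ) ≤ filling c a j := fun a ha => by
      refine (hcj.trans h.le).trans ?_
      rw [← filling.succ_self]
      exact filling.mono ha hij
    rw [horizontal_eq fun a _ ha => ⟨by omega, hc a ha.le⟩,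
      filling.split hij.le (Nat.le_succ j), filling.succ_self, max_eq_left (hc i le_rfl)]

theorem chamberVal_in (hi : 1 ≤ i) (hij : i ≤ j) (hjn : j < n) :
    chamberVal c n i (j + 1) - chamberVal c n i j = filling c i (j + 1) ∨
      1 < i ∧ chamberVal c n i (j + 1) - chamberVal c n (i - 1) (j + 1) = filling c i (j + 1) := by
  rw [chamberVal_horizontal hjn]
  obtain ⟨k, rfl⟩ : ∃ k, i = k + 1 := ⟨i - 1, by omega⟩
  rw [Nat.add_sub_cancel]
  by_cases hk : k = 0
  · subst hk
    exact .inl (horizontal_eq fun a _ _ => by omega)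
  rw [chamberVal_vertical (by omega : 1 ≤ k)]
  rcases le_or_gt (c j : ℝ) (filling c k j) with h | h
  · exact .inl (horizontal_eq fun a _ ha =>
      ⟨by omega, h.trans (filling.mono (by omega) le_rfl)⟩)
  · refine .inr ⟨by omega, ?_⟩
    have hck : (c k : ℝ) ≤ filling c k j := by
      rw [← filling.succ_self]
      exact filling.mono le_rfl hij
    have hc : ∀ b, j < b → (c k : ℝ) ≤ filling c (k + 1) b := fun b hb => by
      refine (hck.trans h.le).trans ?_
      rw [← filling.succ_self]
      exact filling.mono hij hb
    rw [vertical_eq fun b hb _ => ⟨by omega, hc b (by omega)⟩,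
      filling.split (Nat.le_succ k) (by omega : k + 1 ≤ j + 1), filling.succ_self,
      max_eq_right (hc _ (Nat.lt_succ_self j))]

end ChamberVal

theorem PosVal.add_of_le {g g' μ : ℝ} {x y : GPS} (hx : PosVal g x) (hy : PosVal g' y)
    (h : μ ≤ g) (h' : μ ≤ g') (he : g = μ ∨ g' = μ) : PosVal μ (x + y) := by
  refine (hx.add hy).congr ?_
  rcases he with rfl | rfl
  · exact min_eq_left h'
  · exact min_eq_right h

/-- Chamber variables on the triangular quiver whose arrow sums lift an ideal filling. -/
theorem exists_chamber (c : ℕ → NNReal) (n : ℕ) : ∃ x m : ℕ → ℕ → GPS,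
    (∀ i j, x i j ≠ 0) ∧
    (∀ i j, 1 ≤ i → i < j → j ≤ n → PosVal (filling c i j) (m i j)) ∧
    (∀ i j, 1 ≤ i → i < j → j < n → x i (j + 1) / x i j + x (i + 1) j / x i j = m i j) ∧
    (∀ i, 1 ≤ i → i < n → x (i + 1) n / x i n = m i n) ∧
    (∀ i j, 1 ≤ i → i < j → j < n →
      x (i + 1) (j + 1) / x (i + 1) j + x (i + 1) (j + 1) / x i (j + 1) = m (i + 1) (j + 1)) ∧
    (∀ j, 1 ≤ j → j < n → x 1 (j + 1) / x 1 j = m 1 (j + 1)) := by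
  let D : Finset (ℕ × ℕ) := (Finset.Icc 1 n ×ˢ Finset.Icc 1 n).filter fun v => v.1 < v.2
  let out : ℕ × ℕ → Finset (ℕ × ℕ) := fun v =>
    if v.2 < n then {(v.1, v.2 + 1), (v.1 + 1, v.2)} else {(v.1 + 1, v.2)}
  let inn : ℕ × ℕ → Finset (ℕ × ℕ) := fun v =>
    if 1 < v.1 then {(v.1, v.2 - 1), (v.1 - 1, v.2)} else {(v.1, v.2 - 1)}
  have hD : ∀ i j, (i, j) ∈ D ↔ 1 ≤ i ∧ i < j ∧ j ≤ n := fun i j => by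
    simp only [D, Finset.mem_filter, Finset.mem_product, Finset.mem_Icc]
    omega
  have hmem_out : ∀ i j w, w ∈ out (i, j) ↔ (j < n ∧ w = (i, j + 1)) ∨ w = (i + 1, j) := by
    intro i j w
    by_cases h : j < n <;> simp [out, h]
  have hmem_inn : ∀ i j w, w ∈ inn (i, j) ↔ w = (i, j - 1) ∨ (1 < i ∧ w = (i - 1, j)) := by
    intro i j w
    by_cases h : 1 < i <;> simp [inn, h]
  obtain ⟨x, hx, hbal⟩ := exists_balanced (D := D) (out := out) (inn := inn)
    (ρ := fun v => v.1 + v.2) (fun v => chamberVal c n v.1 v.2) (fun v => filling c v.1 v.2)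
    (by
      rintro ⟨i, j⟩ - w hw
      rcases (hmem_out i j w).1 hw with ⟨_, rfl⟩ | rfl <;> simp only <;> omega)
    (by
      rintro ⟨i, j⟩ hv w hw
      rw [hD] at hv
      rcases (hmem_inn i j w).1 hw with rfl | ⟨_, rfl⟩ <;> simp only <;> omega)
    (by
      rintro ⟨i, j⟩ hv w hw
      rw [hD] at hv
      rcases (hmem_out i j w).1 hw with ⟨h, rfl⟩ | rfl
      · simp only [chamberVal_horizontal h]
        exact (filling.mono le_rfl (Nat.le_succ j)).trans filling_le_horizontal
      · simp only [chamberVal_vertical hv.1]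
        exact filling_le_vertical)
    (by
      rintro ⟨i, j⟩ hv w hw
      rw [hD] at hv
      rcases (hmem_inn i j w).1 hw with rfl | ⟨h, rfl⟩
      · obtain ⟨k, rfl⟩ : ∃ k, j = k + 1 := ⟨j - 1, by omega⟩
        simp only [Nat.add_sub_cancel, chamberVal_horizontal (show k < n by omega)]
        exact filling_le_horizontal
      · obtain ⟨k, rfl⟩ : ∃ k, i = k + 1 := ⟨i - 1, by omega⟩
        simp only [Nat.add_sub_cancel, chamberVal_vertical (show 1 ≤ k by omega)]
        exact (filling.mono (Nat.le_succ k) le_rfl).trans filling_le_vertical)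
    (by
      rintro ⟨i, j⟩ hv
      rw [hD] at hv
      rcases chamberVal_out (c := c) hv.1 hv.2.1 hv.2.2 with h | ⟨h, h'⟩
      · exact ⟨(i + 1, j), (hmem_out ..).2 (.inr rfl), h⟩
      · exact ⟨(i, j + 1), (hmem_out ..).2 (.inl ⟨h, rfl⟩), h'⟩)
    (by
      rintro ⟨i, j⟩ hv
      rw [hD] at hv
      obtain ⟨k, rfl⟩ : ∃ k, j = k + 1 := ⟨j - 1, by omega⟩
      rcases chamberVal_in (c := c) hv.1 (by omega : i ≤ k) (by omega : k < n) with h | ⟨h, h'⟩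
      · exact ⟨(i, k), (hmem_inn ..).2 (.inl rfl), h⟩
      · exact ⟨(i - 1, k + 1), (hmem_inn ..).2 (.inr ⟨h, rfl⟩), h'⟩)
  have hout : ∀ i j, j < n → ∑ w ∈ out (i, j), x w / x (i, j) =
      x (i, j + 1) / x (i, j) + x (i + 1, j) / x (i, j) := by
    intro i j h
    simp only [out, h, if_true]
    exact Finset.sum_pair (by simp)
  have hinn : ∀ i j, 1 ≤ i → ∑ u ∈ inn (i + 1, j + 1), x (i + 1, j + 1) / x u =
      x (i + 1, j + 1) / x (i + 1, j) + x (i + 1, j + 1) / x (i, j + 1) := by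
    intro i j h
    simp only [inn, show 1 < i + 1 by omega, if_true, Nat.add_sub_cancel]
    exact Finset.sum_pair (by simp)
  refine ⟨fun i j => x (i, j), fun i j => ∑ w ∈ out (i, j), x w / x (i, j),
    fun i j => (hx _).ne_zero, ?_, ?_, ?_, ?_, ?_⟩
  · intro i j hi hij hjn
    by_cases hj : j < n
    · simp only [hout i j hj]
      refine ((hx _).div (hx _)).add_of_le ((hx _).div (hx _)) ?_ ?_ ?_
      · simp only [chamberVal_horizontal hj]
        exact (filling.mono le_rfl (Nat.le_succ j)).trans filling_le_horizontal
      · simp only [chamberVal_vertical hi]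
        exact filling_le_vertical
      · exact (chamberVal_out (c := c) hi hij hjn).symm.imp_left And.right
    · simp only [out, hj, if_false, Finset.sum_singleton]
      exact ((hx _).div (hx _)).congr
        ((chamberVal_out (c := c) hi hij hjn).resolve_right fun h => hj h.1)
  · intro i j _ _ hj
    exact (hout i j hj).symm
  · intro i _ _
    simp [out]
  · intro i j hi hij hj
    simp only
    rw [hbal _ ((hD _ _).2 ⟨by omega, by omega, by omega⟩), hinn i j hi]
  · intro j hj hjn
    simp only
    rw [hbal _ ((hD _ _).2 ⟨by omega, by omega, by omega⟩)]
    simp [inn]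

/-- The elementary matrix with a single entry one, at position `(i + 1, i)` (1-based). -/
def lowerUnit (n : ℕ) (𝕂 : Type*) [Field 𝕂] (i : ℕ) : Matrix (Fin n) (Fin n) 𝕂 :=
  fun a b => if (a : ℕ) = i ∧ (b : ℕ) + 1 = i then 1 else 0

/-- The entries of a matrix with 1-based indices, extended by zero. -/
def entry {n : ℕ} {𝕂 : Type*} [Field 𝕂] (B : Matrix (Fin n) (Fin n) 𝕂) (r c : ℕ) : 𝕂 :=
  if h : (1 ≤ r ∧ r ≤ n) ∧ 1 ≤ c ∧ c ≤ n then B ⟨r - 1, by omega⟩ ⟨c - 1, by omega⟩ else 0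

section Entry

variable {n : ℕ} {𝕂 : Type*} [Field 𝕂]

theorem yMat_eq (i : ℕ) (z : 𝕂) : yMat n 𝕂 i z = 1 + z • lowerUnit n 𝕂 i := by
  ext a b
  simp only [yMat, lowerUnit, Matrix.add_apply, Matrix.smul_apply, Matrix.one_apply, smul_eq_mul]
  by_cases h : a = b
  · subst h
    simp only [if_true]
    rw [if_neg (by omega)]
    simp
  · simp [h]

theorem entry_yMat_mul {j : ℕ} (hj : 1 ≤ j) (hjn : j < n) (z : 𝕂)
    (B : Matrix (Fin n) (Fin n) 𝕂) (r c : ℕ) :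
    entry (yMat n 𝕂 j z * B) r c = entry B r c + (if r = j + 1 then z else 0) * entry B (r - 1) c := by
  unfold entry
  by_cases h : (1 ≤ r ∧ r ≤ n) ∧ 1 ≤ c ∧ c ≤ n
  · rw [dif_pos h, dif_pos h, yMat_eq, add_mul, one_mul, Matrix.add_apply, smul_mul_assoc,
      Matrix.smul_apply, smul_eq_mul, Matrix.mul_apply]
    congr 1
    simp only [lowerUnit]
    by_cases hr : r = j + 1
    · subst hr
      rw [if_pos rfl, dif_pos ⟨⟨by omega, by omega⟩, h.2⟩]
      congr 1
      rw [Finset.sum_eq_single ⟨j - 1, by omega⟩]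
      · rw [if_pos ⟨by simp, by simp only; omega⟩, one_mul]
        rfl
      · intro b _ hb
        rw [if_neg, zero_mul]
        rintro ⟨-, h2⟩
        exact hb (Fin.ext (by simp only; omega))
      · simp
    · rw [if_neg hr, zero_mul, Finset.sum_eq_zero, mul_zero]
      intro b _
      rw [if_neg (by omega), zero_mul]
  · rw [dif_neg h, dif_neg h]
    by_cases hr : r = j + 1
    · rw [dif_neg (by omega)]
      simp
    · simp [hr]

/-- The product `y_1(ζ 2) y_2(ζ 3) ⋯ y_k(ζ (k + 1))`. -/
def rowProd (n : ℕ) {𝕂 : Type*} [Field 𝕂] (ζ : ℕ → 𝕂) (k : ℕ) : Matrix (Fin n) (Fin n) 𝕂 :=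
  ((List.range k).map fun t => yMat n 𝕂 (t + 1) (ζ (t + 2))).prod

theorem rowProd_succ (ζ : ℕ → 𝕂) (k : ℕ) :
    rowProd n ζ (k + 1) = rowProd n ζ k * yMat n 𝕂 (k + 1) (ζ (k + 2)) := by
  simp [rowProd, List.range_succ]

theorem entry_rowProd_mul (ζ : ℕ → 𝕂) {k : ℕ} (hk : k < n)
    (B : Matrix (Fin n) (Fin n) 𝕂) (r c : ℕ) :
    entry (rowProd n ζ k * B) r c =
      entry B r c + (if 2 ≤ r ∧ r ≤ k + 1 then ζ r else 0) * entry B (r - 1) c := by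
  induction k generalizing B with
  | zero =>
    rw [if_neg (by omega)]
    simp [rowProd]
  | succ k ih =>
    rw [rowProd_succ, mul_assoc, ih (by omega), entry_yMat_mul (by omega) hk,
      entry_yMat_mul (by omega) hk]
    by_cases h1 : r = k + 2
    · rw [if_pos h1, if_neg (show ¬ (2 ≤ r ∧ r ≤ k + 1) by omega),
        if_pos (show 2 ≤ r ∧ r ≤ k + 1 + 1 by omega), h1]
      ring
    · rw [if_neg h1]
      by_cases h2 : 2 ≤ r ∧ r ≤ k + 1
      · rw [if_pos h2, if_pos (show 2 ≤ r ∧ r ≤ k + 1 + 1 by omega),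
          if_neg (show ¬ r - 1 = k + 1 + 1 by omega)]
        ring
      · rw [if_neg h2, if_neg (show ¬ (2 ≤ r ∧ r ≤ k + 1 + 1) by omega)]
        ring

end Entry

/-- The defect-corrected Toeplitz relation satisfied by the partial products. -/
structure TwistedToeplitz {𝕂 : Type*} [Field 𝕂] (n : ℕ) (α β : ℕ → 𝕂) (P : ℕ → ℕ → 𝕂) : Prop where
  row_zero : ∀ c, P 0 c = 0
  row_one : ∀ c, 1 ≤ c → P 1 (c + 1) = 0
  rel : ∀ r c, 1 ≤ r → r < n → 1 ≤ c → c < n →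
    P (r + 1) (c + 1) = P r c - α r * P r (c + 1) + β r * P (r - 1) c

theorem TwistedToeplitz.step {𝕂 : Type*} [Field 𝕂] {n : ℕ} {α β α' β' ζ : ℕ → 𝕂}
    {P P' : ℕ → ℕ → 𝕂} (h : TwistedToeplitz n α β P)
    (hP' : ∀ r c, P' r c = P r c + ζ r * P (r - 1) c)
    (hα : ∀ r, 1 ≤ r → r < n → α r = ζ (r + 1))
    (hβ : ∀ r, 2 ≤ r → r < n → β r = ζ r - α' r + β' r)
    (hαβ : ∀ r, 3 ≤ r → r < n → β' r * ζ (r - 1) = α' r * β (r - 1)) :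
    TwistedToeplitz n α' β' P' := by
  refine ⟨fun c => by simp [hP', h.row_zero], fun c hc => by simp [hP', h.row_zero, h.row_one c hc],
    fun r c hr hrn hc hcn => ?_⟩
  simp only [hP', Nat.add_sub_cancel]
  rw [h.rel r c hr hrn hc hcn, hα r hr hrn]
  rcases (show r = 1 ∨ 2 ≤ r by omega) with rfl | hr2
  · simp [h.row_zero, h.row_one c hc]
  · obtain ⟨s, rfl⟩ : ∃ s, r = s + 1 := ⟨r - 1, by omega⟩
    have h1 := h.rel s c (by omega) (by omega) hc hcn
    rw [hα s (by omega) (by omega)] at h1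
    have h2 : (β' (s + 1) * ζ s - α' (s + 1) * β s) * P (s - 1) c = 0 := by
      rcases (show s = 1 ∨ 2 ≤ s by omega) with rfl | hs
      · simp [h.row_zero]
      · have := hαβ (s + 1) (by omega) hrn
        rw [Nat.add_sub_cancel] at this
        rw [this, sub_self, zero_mul]
    rw [hβ (s + 1) hr2 hrn]
    simp only [Nat.add_sub_cancel]
    linear_combination α' (s + 1) * h1 - h2

section Staircase

variable {n : ℕ} {𝕂 : Type*} [Field 𝕂]

/-- The product of the rows `i, i + 1, …, i + k - 1` of the standard factorization. -/
def stairProd (n : ℕ) {𝕂 : Type*} [Field 𝕂] (z : ℕ → ℕ → 𝕂) (i k : ℕ) :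
    Matrix (Fin n) (Fin n) 𝕂 :=
  ((List.range' i k).map fun i => rowProd n (fun r => z i (i + r - 1)) (n - i)).prod

theorem stairProd_succ (z : ℕ → ℕ → 𝕂) (i k : ℕ) : stairProd n z i (k + 1) =
    rowProd n (fun r => z i (i + r - 1)) (n - i) * stairProd n z (i + 1) k := by
  simp [stairProd, List.range'_succ]

theorem stairProd_snoc (z : ℕ → ℕ → 𝕂) (i k : ℕ) : stairProd n z i (k + 1) =
    stairProd n z i k * rowProd n (fun r => z (i + k) (i + k + r - 1)) (n - (i + k)) := by
  simp [stairProd, List.range'_concat]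

/-- The standard factorization with parameters `1 / m` is Toeplitz when the `m` are the arrow sums
of a balanced labelling `x` of the triangular quiver. -/
theorem stairProd_toeplitz {x m z : ℕ → ℕ → 𝕂}
    (hx : ∀ i j, x i j ≠ 0)
    (hm : ∀ i j, 1 ≤ i → i < j → j ≤ n → m i j ≠ 0)
    (hout : ∀ i j, 1 ≤ i → i < j → j < n → x i (j + 1) / x i j + x (i + 1) j / x i j = m i j)
    (hout' : ∀ i, 1 ≤ i → i < n → x (i + 1) n / x i n = m i n)
    (hin : ∀ i j, 1 ≤ i → i < j → j < n →
      x (i + 1) (j + 1) / x (i + 1) j + x (i + 1) (j + 1) / x i (j + 1) = m (i + 1) (j + 1))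
    (hin' : ∀ j, 1 ≤ j → j < n → x 1 (j + 1) / x 1 j = m 1 (j + 1))
    (hz : ∀ i j, 1 ≤ i → i < j → j ≤ n → z i j = (m i j)⁻¹)
    (hz0 : ∀ j, z 0 j = 0) (hzn : ∀ i j, n < j → z i j = 0)
    (r c : ℕ) (hr : 1 ≤ r) (hrn : r < n) (hc : 1 ≤ c) (hcn : c < n) :
    entry (stairProd n z 1 (n - 1)) (r + 1) (c + 1) = entry (stairProd n z 1 (n - 1)) r c := by
  let H : ℕ → ℕ → 𝕂 := fun i j => if j < n then x i (j + 1) / x i j else 0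
  have hH : ∀ i j, j < n → H i j = x i (j + 1) / x i j := fun i j h => if_pos h
  have hHn : ∀ i j, n ≤ j → H i j = 0 := fun i j h => if_neg (by omega)
  have hslide : ∀ i j, 1 ≤ i → i < j → H i j * z i j = H (i + 1) j * z (i + 1) (j + 1) := by
    intro i j hi hij
    rcases lt_or_ge j n with hj | hj
    · rw [hz i j hi hij hj.le, hz (i + 1) (j + 1) (by omega) (by omega) hj, hH _ _ hj, hH _ _ hj]
      have n1 := hm i j hi hij hj.le
      have n2 := hm (i + 1) (j + 1) (by omega) (by omega) hj
      rw [← div_eq_mul_inv, ← div_eq_mul_inv, div_eq_div_iff n1 n2, ← hin i j hi hij hj,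
        ← hout i j hi hij hj]
      have := hx i j
      have := hx (i + 1) j
      have := hx i (j + 1)
      field_simp
    · rw [hHn _ _ hj, hHn _ _ hj, zero_mul, zero_mul]
  have hbox : ∀ i j, i + 2 ≤ j → (i = 0 → j < n) → H (i + 1) j * z (i + 1) j * z (i + 1) (j + 1) =
      z (i + 1) j - z i j + H i (j - 1) * z i (j - 1) * z i j := by
    intro i j hij hj0
    rcases Nat.eq_zero_or_pos i with rfl | hi
    · have hj := hj0 rfl
      have n1 := hm 1 (j + 1) le_rfl (by omega) hj
      rw [hz0, hz0, hH _ _ hj, hin' j (by omega) hj, hz 1 (j + 1) le_rfl (by omega) hj]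
      field_simp
      ring
    rcases lt_or_ge n j with hj | hj
    · rw [hzn i j hj, hzn (i + 1) j hj]
      ring
    have h1 := hslide i j hi (by omega)
    obtain ⟨k, rfl⟩ : ∃ k, j = k + 1 := ⟨j - 1, by omega⟩
    have h2 := hslide i k hi (by omega)
    have n1 := hm i (k + 1) hi (by omega) hj
    have n2 := hm (i + 1) (k + 1) (by omega) (by omega) hj
    have h3 : m i (k + 1) = H i (k + 1) + x (i + 1) (k + 1) / x i (k + 1) := by
      rcases hj.eq_or_lt with rfl | hj'
      · rw [hHn _ _ le_rfl, zero_add, hout' i hi (by omega)]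
      · rw [hH _ _ hj', hout i (k + 1) hi (by omega) hj']
    have h4 : m (i + 1) (k + 1) = H (i + 1) k + x (i + 1) (k + 1) / x i (k + 1) := by
      rw [hH _ _ hj, hin i k hi (by omega) hj]
    rw [Nat.add_sub_cancel, h2, mul_right_comm, ← h1, hz i (k + 1) hi (by omega) hj,
      hz (i + 1) (k + 1) (by omega) (by omega) hj]
    field_simp
    linear_combination h4 - h3
  have key : ∀ t, t + 1 ≤ n → TwistedToeplitz n (fun r => z (n - t - 1) (n - t - 1 + r))
      (fun r => H (n - t - 1) (n - t - 1 + r - 1) * z (n - t - 1) (n - t - 1 + r - 1) *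
        z (n - t - 1) (n - t - 1 + r)) (entry (stairProd n z (n - t) t)) := by
    intro t
    induction t with
    | zero =>
      intro _
      have e : ∀ r c, entry (stairProd n z (n - 0) 0 : Matrix (Fin n) (Fin n) 𝕂) r c =
          if r = c ∧ 1 ≤ r ∧ r ≤ n then 1 else 0 := by
        intro r c
        simp only [entry, stairProd, List.range'_zero, List.map_nil, List.prod_nil, Matrix.one_apply,
          Fin.mk.injEq]
        split_ifs <;> first | rfl | omega
      refine ⟨fun c => ?_, fun c hc => ?_, fun r c hr hrn hc hcn => ?_⟩
      · rw [e, if_neg (by omega)]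
      · rw [e, if_neg (by omega)]
      · simp only [e]
        rcases (show r = 1 ∨ 2 ≤ r by omega) with rfl | hr2
        · rw [if_neg (by omega : ¬ (1 = c + 1 ∧ 1 ≤ 1 ∧ 1 ≤ n)),
            if_neg (by omega : ¬ (1 - 1 = c ∧ 1 ≤ 1 - 1 ∧ 1 - 1 ≤ n))]
          by_cases h : 1 = c
          · rw [if_pos ⟨by omega, by omega, by omega⟩, if_pos ⟨h, by omega, by omega⟩]
            ring
          · rw [if_neg (by omega), if_neg (by omega)]
            simp
        · rw [hzn _ (n - 0 - 1 + r) (by omega)]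
          by_cases h : r = c
          · rw [if_pos ⟨by omega, by omega, by omega⟩, if_pos ⟨h, by omega, by omega⟩]
            ring
          · rw [if_neg (by omega), if_neg (by omega : ¬ (r = c ∧ 1 ≤ r ∧ r ≤ n))]
            ring
    | succ t ih =>
      intro ht
      obtain ⟨i, hi⟩ : ∃ i, n - t = i + 2 := ⟨n - t - 2, by omega⟩
      have h := ih (by omega)
      have e1 : n - (t + 1) = i + 1 := by omega
      rw [e1, Nat.add_sub_cancel]
      rw [hi, show i + 2 - 1 = i + 1 by omega] at h
      refine h.step (ζ := fun r => z (i + 1) (i + 1 + r - 1)) (fun r c => ?_) (fun r _ _ => ?_)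
        (fun r hr hrn => ?_) (fun r hr hrn => ?_)
      · rw [stairProd_succ, entry_rowProd_mul _ (by omega)]
        congr 1
        by_cases h2 : 2 ≤ r
        · by_cases h3 : r ≤ n - (i + 1) + 1
          · rw [if_pos ⟨h2, h3⟩]
          · rw [if_neg (fun h => h3 h.2), hzn _ (i + 1 + r - 1) (by omega)]
        · have h0 : entry (stairProd n z (i + 2) t) (r - 1) c = 0 := by
            rw [show r - 1 = 0 by omega]
            exact h.row_zero c
          rw [h0, mul_zero, mul_zero]
      · congr 1
      · have := hbox i (i + r) (by omega) (by omega)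
        rw [show i + 1 + r - 1 = i + r by omega, show i + 1 + r = i + r + 1 by omega, this]
      · rw [show i + 1 + (r - 1) - 1 = i + r - 1 by omega,
          show i + 1 + (r - 1) = i + r by omega]
        rcases Nat.eq_zero_or_pos i with rfl | hi
        · simp [hz0]
        · have := hslide i (i + r - 1) hi (by omega)
          rw [Nat.sub_add_cancel (by omega)] at this
          rw [this]
          ring
  have h := key (n - 1) (by omega)
  rw [show n - (n - 1) = 1 by omega] at h
  have := h.rel r c hr hrn hc hcn
  simpa [hz0] using this

end Staircase

section Braid

variable {n : ℕ} {𝕂 : Type*} [Field 𝕂]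

theorem lowerUnit_mul_eq_zero {i j : ℕ} (h : i ≠ j + 1) :
    lowerUnit n 𝕂 i * lowerUnit n 𝕂 j = 0 := by
  ext a b
  rw [Matrix.mul_apply, Finset.sum_eq_zero, Matrix.zero_apply]
  intro c _
  simp only [lowerUnit]
  by_cases h1 : (a : ℕ) = i ∧ (c : ℕ) + 1 = i
  · rw [if_neg (by omega : ¬ ((c : ℕ) = j ∧ (b : ℕ) + 1 = j)), mul_zero]
  · rw [if_neg h1, zero_mul]

theorem yMat_commute {i j : ℕ} (h : i ≠ j + 1) (h' : j ≠ i + 1) (a b : 𝕂) :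
    yMat n 𝕂 i a * yMat n 𝕂 j b = yMat n 𝕂 j b * yMat n 𝕂 i a := by
  simp only [yMat_eq, mul_add, add_mul, mul_one, one_mul, smul_mul_smul_comm,
    lowerUnit_mul_eq_zero h, lowerUnit_mul_eq_zero h', smul_zero, add_zero]
  abel

theorem yMat_braid (i : ℕ) {a b c a' b' c' : 𝕂} (h1 : a + c = b') (h2 : b = a' + c')
    (h3 : b * c = a' * b') :
    yMat n 𝕂 i a * yMat n 𝕂 (i + 1) b * yMat n 𝕂 i c =
      yMat n 𝕂 (i + 1) a' * yMat n 𝕂 i b' * yMat n 𝕂 (i + 1) c' := by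
  have e1 : lowerUnit n 𝕂 i * lowerUnit n 𝕂 i = 0 := lowerUnit_mul_eq_zero (by omega)
  have e2 : lowerUnit n 𝕂 (i + 1) * lowerUnit n 𝕂 (i + 1) = 0 := lowerUnit_mul_eq_zero (by omega)
  have e3 : lowerUnit n 𝕂 i * lowerUnit n 𝕂 (i + 1) = 0 := lowerUnit_mul_eq_zero (by omega)
  simp only [yMat_eq, mul_add, add_mul, mul_one, one_mul, smul_mul_smul_comm, mul_assoc,
    e1, e2, e3, smul_zero, add_zero, mul_zero, ← h1]
  rw [h2, ← h1] at h3
  have h4 : a' * a = c' * c := by linear_combination -h3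
  rw [h2, h4]
  module

end Braid

theorem swap_braid (i : ℕ) :
    Equiv.swap i (i + 1) * Equiv.swap (i + 1) (i + 2) * Equiv.swap i (i + 1) =
      Equiv.swap (i + 1) (i + 2) * Equiv.swap i (i + 1) * Equiv.swap (i + 1) (i + 2) := by
  rw [Equiv.swap_mul_swap_mul_swap (by omega) (by omega), Equiv.swap_comm i (i + 1),
    Equiv.swap_comm (i + 1) (i + 2), Equiv.swap_mul_swap_mul_swap (by omega) (by omega),
    Equiv.swap_comm]

theorem exists_braid_params {g g' : ℝ} {m₁ m₂ m₃ : GPS} (h₁ : PosVal g m₁)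
    (h₂ : PosVal (max g g') m₂) (h₃ : PosVal g' m₃) :
    ∃ p₁ p₂ p₃ : GPS, PosVal g' p₁ ∧ PosVal (max g g') p₂ ∧ PosVal g p₃ ∧
      m₁⁻¹ + m₃⁻¹ = p₂⁻¹ ∧ m₂⁻¹ = p₁⁻¹ + p₃⁻¹ ∧ m₂⁻¹ * m₃⁻¹ = p₁⁻¹ * p₂⁻¹ ∧
      p₂⁻¹ * p₃⁻¹ = m₁⁻¹ * m₂⁻¹ := by
  have h := h₁.add h₃
  have e := max_add_min g g'
  have n1 := h₁.ne_zero
  have n2 := h₂.ne_zero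
  have n3 := h₃.ne_zero
  have n4 := h.ne_zero
  refine ⟨m₂ * (m₁ + m₃) / m₁, m₁ * m₃ / (m₁ + m₃), m₂ * (m₁ + m₃) / m₃,
    ((h₂.mul h).div h₁).congr (by linarith), ((h₁.mul h₃).div h).congr (by linarith),
    ((h₂.mul h).div h₃).congr (by linarith), ?_, ?_, ?_, ?_⟩ <;> field_simp
  ring

/-- `Factorization c n k w A`: the matrix `A` is a product of `k` factors `y_i(m⁻¹)` along a
length-increasing word for `w`, with valuations given by the filling at the inversions. -/
inductive Factorization (c : ℕ → NNReal) (n : ℕ) :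
    ℕ → Equiv.Perm ℕ → Matrix (Fin n) (Fin n) GPS → Prop
  | nil : Factorization c n 0 1 1
  | snoc {k : ℕ} {w : Equiv.Perm ℕ} {A : Matrix (Fin n) (Fin n) GPS} {i : ℕ} {m : GPS} :
      Factorization c n k w A → 1 ≤ i → i < n → w i < w (i + 1) →
      PosVal (filling c (w i) (w (i + 1))) m →
      Factorization c n (k + 1) (w * Equiv.swap i (i + 1)) (A * yMat n GPS i m⁻¹)

namespace Factorization

variable {c : ℕ → NNReal} {n : ℕ}

theorem snoc' {k : ℕ} {w w' : Equiv.Perm ℕ} {A : Matrix (Fin n) (Fin n) GPS} {i a b : ℕ} {m : GPS}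
    (h : Factorization c n k w A) (hi : 1 ≤ i) (hin : i < n) (ha : w i = a) (hb : w (i + 1) = b)
    (hab : a < b) (hm : PosVal (filling c a b) m) (hw : w * Equiv.swap i (i + 1) = w') :
    Factorization c n (k + 1) w' (A * yMat n GPS i m⁻¹) := by
  subst ha hb hw
  exact h.snoc hi hin hab hm

theorem zero_iff {w : Equiv.Perm ℕ} {A : Matrix (Fin n) (Fin n) GPS} :
    Factorization c n 0 w A ↔ w = 1 ∧ A = 1 := by
  constructor
  · rintro ⟨⟩
    exact ⟨rfl, rfl⟩
  · rintro ⟨rfl, rfl⟩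
    exact nil

theorem exists_of_succ {k : ℕ} {w : Equiv.Perm ℕ} {A : Matrix (Fin n) (Fin n) GPS}
    (h : Factorization c n (k + 1) w A) : ∃ v B i m, Factorization c n k v B ∧ 1 ≤ i ∧ i < n ∧
      v i < v (i + 1) ∧ PosVal (filling c (v i) (v (i + 1))) m ∧ w = v * Equiv.swap i (i + 1) ∧
      A = B * yMat n GPS i m⁻¹ := by
  cases h with
  | snoc h hi hin hlt hm => exact ⟨_, _, _, _, h, hi, hin, hlt, hm, rfl, rfl⟩

/-- Every descent of `w` can be made the last letter of the factorization. -/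
theorem strip {k : ℕ} {w : Equiv.Perm ℕ} {A : Matrix (Fin n) (Fin n) GPS} {i : ℕ}
    (h : Factorization c n k w A) (hi : 1 ≤ i) (hin : i < n) (hd : w (i + 1) < w i) :
    ∃ k' B m, k = k' + 1 ∧ Factorization c n k' (w * Equiv.swap i (i + 1)) B ∧
      PosVal (filling c (w (i + 1)) (w i)) m ∧ A = B * yMat n GPS i m⁻¹ := by
  induction k using Nat.strong_induction_on generalizing w A i with
  | _ k ih =>
  rcases k with _ | k
  · obtain ⟨rfl, -⟩ := zero_iff.1 h
    simp at hd
  obtain ⟨v, A', j, mj, h', hj, hjn, hlt, hmj, rfl, rfl⟩ := h.exists_of_succ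
  simp only [Equiv.Perm.mul_apply] at hd ⊢
  have hsw : ∀ x, x ≠ j → x ≠ j + 1 → Equiv.swap j (j + 1) x = x := fun x h1 h2 =>
    Equiv.swap_apply_of_ne_of_ne h1 h2
  rcases (show i = j ∨ j = i + 1 ∨ i = j + 1 ∨ (i ≠ j ∧ i ≠ j + 1 ∧ j ≠ i + 1) by omega) with
    rfl | rfl | rfl | ⟨h1, h2, h3⟩
  · refine ⟨k, A', mj, rfl, ?_, ?_, rfl⟩
    · rwa [Equiv.mul_swap_mul_self]
    · simpa using hmj
  · rw [Equiv.swap_apply_left, hsw i (by omega) (by omega)] at hd ⊢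
    obtain ⟨k, A₁, m₂, rfl, g₁, hm₂, rfl⟩ := ih _ (by omega) h' hi (by omega) (by omega)
    have t1 : Equiv.swap i (i + 1) (i + 2) = i + 2 :=
      Equiv.swap_apply_of_ne_of_ne (by omega) (by omega)
    obtain ⟨k, A₂, m₁, rfl, g₂, hm₁, rfl⟩ := ih _ (by omega) g₁ hj hjn (by
      simpa only [Equiv.Perm.mul_apply, Equiv.swap_apply_right, t1] using hd)
    simp only [Equiv.Perm.mul_apply, Equiv.swap_apply_right, t1] at hm₁
    have t2 : Equiv.swap (i + 1) (i + 1 + 1) i = i :=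
      Equiv.swap_apply_of_ne_of_ne (by omega) (by omega)
    rw [filling.split hlt.le hd.le, max_comm] at hm₂
    obtain ⟨p₁, p₂, p₃, hp₁, hp₂, hp₃, e1, e2, e3, e4⟩ := exists_braid_params hm₁ hm₂ hmj
    rw [max_comm, ← filling.split hlt.le hd.le] at hp₂
    refine ⟨_, _, p₃, rfl, (g₂.snoc' hi (by omega) (a := v (i + 1)) (b := v (i + 2)) ?_ ?_ hlt hp₁
      rfl).snoc' hj hjn (a := v (i + 1)) (b := v i) ?_ ?_ (by omega) hp₂ ?_, hp₃, ?_⟩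
    · simp [t2]
    · simp [t1]
    · simp [t2]
    · simp [t1]
    · simp only [mul_assoc]
      congr 1
      simp only [← mul_assoc]
      rw [swap_braid, mul_assoc, Equiv.swap_mul_self, mul_one]
    · simp only [mul_assoc]
      congr 1
      simp only [← mul_assoc]
      rw [yMat_braid i e2.symm e1.symm e4]
  · have t1 : Equiv.swap (j + 1) (j + 2) j = j :=
      Equiv.swap_apply_of_ne_of_ne (by omega) (by omega)
    have t2 : Equiv.swap j (j + 1) (j + 2) = j + 2 :=
      Equiv.swap_apply_of_ne_of_ne (by omega) (by omega)
    rw [Equiv.swap_apply_right, t2] at hd ⊢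
    obtain ⟨k, A₁, m₂, rfl, g₁, hm₂, rfl⟩ := ih _ (by omega) h' hi hin (hd.trans hlt)
    obtain ⟨k, A₂, m₁, rfl, g₂, hm₁, rfl⟩ := ih _ (by omega) g₁ hj hjn (by
      simpa only [Equiv.Perm.mul_apply, Equiv.swap_apply_left, t1] using hd)
    simp only [Equiv.Perm.mul_apply, Equiv.swap_apply_left, t1] at hm₁
    rw [filling.split hd.le hlt.le] at hm₂
    obtain ⟨p₁, p₂, p₃, hp₁, hp₂, hp₃, e1, e2, e3, e4⟩ := exists_braid_params hm₁ hm₂ hmj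
    rw [← filling.split hd.le hlt.le] at hp₂
    refine ⟨_, _, p₃, rfl, (g₂.snoc' hi hin (a := v j) (b := v (j + 1)) ?_ ?_ hlt hp₁
      rfl).snoc' hj hjn (a := v (j + 2)) (b := v (j + 1)) ?_ ?_ (by omega) hp₂ ?_, hp₃, ?_⟩
    · simp [t1]
    · simp [t2]
    · simp [t1]
    · simp [t2]
    · simp only [mul_assoc]
      congr 1
      simp only [← mul_assoc]
      rw [← swap_braid, mul_assoc, Equiv.swap_mul_self, mul_one]
    · simp only [mul_assoc]
      congr 1
      simp only [← mul_assoc]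
      rw [yMat_braid j e1 e2 e3]
  · rw [hsw i h1 h2, hsw (i + 1) (by omega) (by omega)] at hd ⊢
    obtain ⟨k, B, m, rfl, g, hm, rfl⟩ := ih _ (Nat.lt_succ_self _) h' hi hin hd
    have hsw' : ∀ x, x ≠ i → x ≠ i + 1 → Equiv.swap i (i + 1) x = x := fun x h1 h2 =>
      Equiv.swap_apply_of_ne_of_ne h1 h2
    refine ⟨k + 1, B * yMat n GPS j mj⁻¹, m, rfl, g.snoc' hj hjn (a := v j) (b := v (j + 1))
      ?_ ?_ hlt hmj ?_, hm, ?_⟩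
    · rw [Equiv.Perm.mul_apply, hsw' j (by omega) (by omega)]
    · rw [Equiv.Perm.mul_apply, hsw' (j + 1) (by omega) (by omega)]
    · rw [mul_assoc, mul_assoc]
      congr 1
      exact (Equiv.Perm.Disjoint.commute (Equiv.Perm.disjoint_swap_swap (by
        simp; omega))).eq
    · rw [mul_assoc, mul_assoc, yMat_commute h2 h3]

end Factorization

/-- The permutation of `ℕ` given by the first `k` letters of the word `i 1, i 2, …`. -/
def wordPerm (i : ℕ → ℕ) (k : ℕ) : Equiv.Perm ℕ :=
  ((List.range k).map fun t => Equiv.swap (i (t + 1)) (i (t + 1) + 1)).prod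

theorem wordPerm_succ (i : ℕ → ℕ) (k : ℕ) :
    wordPerm i (k + 1) = wordPerm i k * Equiv.swap (i (k + 1)) (i (k + 1) + 1) := by
  simp [wordPerm, List.range_succ]

namespace Factorization

variable {c : ℕ → NNReal} {n : ℕ}

/-- A factorization of `w` is no longer than any word for `w`. -/
theorem le_length {i : ℕ → ℕ} {l k : ℕ} (hi : ∀ j, 1 ≤ j → j ≤ l → 1 ≤ i j ∧ i j < n)
    {A : Matrix (Fin n) (Fin n) GPS} (h : Factorization c n k (wordPerm i l) A) : k ≤ l := by
  induction l generalizing k A with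
  | zero =>
    rcases k with _ | k
    · exact le_rfl
    obtain ⟨v, B, j, m, -, -, -, hlt, -, hw, -⟩ := h.exists_of_succ
    have hv : v = Equiv.swap j (j + 1) := by
      rw [eq_mul_inv_of_mul_eq hw.symm, Equiv.swap_inv]
      simp [wordPerm]
    rw [hv, Equiv.swap_apply_left, Equiv.swap_apply_right] at hlt
    omega
  | succ l ih =>
    have hil := hi (l + 1) (by omega) le_rfl
    have hi' : ∀ j, 1 ≤ j → j ≤ l → 1 ≤ i j ∧ i j < n := fun j h1 h2 => hi j h1 (by omega)
    have hw : wordPerm i (l + 1) * Equiv.swap (i (l + 1)) (i (l + 1) + 1) = wordPerm i l := by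
      rw [wordPerm_succ, Equiv.mul_swap_mul_self]
    rcases lt_trichotomy (wordPerm i (l + 1) (i (l + 1))) (wordPerm i (l + 1) (i (l + 1) + 1))
      with hlt | heq | hgt
    · have := ih hi' (hw ▸ h.snoc hil.1 hil.2 hlt (PosVal.single one_pos))
      omega
    · have := (wordPerm i (l + 1)).injective heq
      omega
    · obtain ⟨k', B, m, rfl, h', -⟩ := h.strip hil.1 hil.2 hgt
      rw [hw] at h'
      have := ih hi' h'
      omega

/-- A factorization of maximal length can be rewritten along any word of the same length. -/
theorem exists_along {i : ℕ → ℕ} {k : ℕ} (hi : ∀ j, 1 ≤ j → j ≤ k → 1 ≤ i j ∧ i j < n)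
    {A : Matrix (Fin n) (Fin n) GPS} (h : Factorization c n k (wordPerm i k) A) :
    ∃ m : ℕ → GPS, (∀ j, j < k → wordPerm i j (i (j + 1)) < wordPerm i j (i (j + 1) + 1) ∧ PosVal
        (filling c (wordPerm i j (i (j + 1))) (wordPerm i j (i (j + 1) + 1))) (m (j + 1))) ∧
      A = ((List.range k).map fun t => yMat n GPS (i (t + 1)) (m (t + 1))⁻¹).prod := by
  induction k generalizing A with
  | zero =>
    refine ⟨0, fun j hj => by omega, ?_⟩
    rw [(zero_iff.1 h).2]
    simp
  | succ k ih =>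
    have hik := hi (k + 1) (by omega) le_rfl
    have hi' : ∀ j, 1 ≤ j → j ≤ k → 1 ≤ i j ∧ i j < n := fun j h1 h2 => hi j h1 (by omega)
    have hw : wordPerm i (k + 1) * Equiv.swap (i (k + 1)) (i (k + 1) + 1) = wordPerm i k := by
      rw [wordPerm_succ, Equiv.mul_swap_mul_self]
    have hd : wordPerm i (k + 1) (i (k + 1) + 1) < wordPerm i (k + 1) (i (k + 1)) := by
      by_contra hle
      have hlt : wordPerm i (k + 1) (i (k + 1)) < wordPerm i (k + 1) (i (k + 1) + 1) :=
        lt_of_le_of_ne (not_lt.1 hle) fun heq => by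
          have := (wordPerm i (k + 1)).injective heq
          omega
      have := le_length hi' (hw ▸ h.snoc hik.1 hik.2 hlt (PosVal.single one_pos))
      omega
    obtain ⟨k', B, p, hk', h', hp, rfl⟩ := h.strip hik.1 hik.2 hd
    obtain rfl : k = k' := by omega
    rw [hw] at h'
    obtain ⟨m, hm, rfl⟩ := ih hi' h'
    refine ⟨Function.update m (k + 1) p, fun j hj => ?_, ?_⟩
    · rcases (show j = k ∨ j < k by omega) with rfl | hj'
      · rw [Function.update_self]
        simpa [wordPerm_succ] using And.intro hd hp
      · rw [Function.update_of_ne (by omega)]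
        exact hm j hj'
    · rw [List.range_succ, List.map_append, List.prod_append, List.map_singleton,
        List.prod_singleton, Function.update_self]
      congr 2
      refine List.map_congr_left fun t ht => ?_
      rw [Function.update_of_ne (by have := List.mem_range.1 ht; omega)]

/-- The standard factorization, up to the first `k` letters of row `i + 1`. -/
theorem exists_stair {m z : ℕ → ℕ → GPS}
    (hm : ∀ i j, 1 ≤ i → i < j → j ≤ n → PosVal (filling c i j) (m i j))
    (hz : ∀ i j, 1 ≤ i → i < j → j ≤ n → z i j = (m i j)⁻¹) {i : ℕ} (hi : i < n) :
    ∃ w, Factorization c n (∑ t ∈ Finset.range i, (n - 1 - t)) w (stairProd n z 1 i) ∧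
      ∀ x, w x = if 1 ≤ x ∧ x ≤ n then if x ≤ n - i then x + i else n + 1 - x else x := by
  induction i with
  | zero =>
    refine ⟨1, by simpa [stairProd] using nil, fun x => ?_⟩
    simp only [Equiv.Perm.one_apply]
    split_ifs <;> omega
  | succ i ih =>
    obtain ⟨w, h, hw⟩ := ih (by omega)
    suffices H : ∀ k, k ≤ n - 1 - i → ∃ w,
        Factorization c n (∑ t ∈ Finset.range i, (n - 1 - t) + k) w
          (stairProd n z 1 i * rowProd n (fun r => z (1 + i) (1 + i + r - 1)) k) ∧
        ∀ x, w x = if 1 ≤ x ∧ x ≤ n then if x ≤ k then x + 1 + i else if x = k + 1 then i + 1 else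
          if x ≤ n - i then x + i else n + 1 - x else x by
      obtain ⟨w, h, hw⟩ := H (n - 1 - i) le_rfl
      refine ⟨w, ?_, fun x => ?_⟩
      · rw [Finset.sum_range_succ, stairProd_snoc, show n - (1 + i) = n - 1 - i by omega]
        exact h
      · rw [hw]
        split_ifs <;> omega
    intro k
    induction k with
    | zero =>
      intro _
      refine ⟨w, by simpa [rowProd] using h, fun x => ?_⟩
      rw [hw]
      split_ifs <;> omega
    | succ k ih =>
      intro hk
      obtain ⟨w, h, hw⟩ := ih (by omega)
      refine ⟨w * Equiv.swap (k + 1) (k + 1 + 1), ?_, fun x => ?_⟩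
      · rw [rowProd_succ, ← mul_assoc, hz (1 + i) (1 + i + (k + 2) - 1) (by omega) (by omega)
          (by omega), ← add_assoc]
        refine h.snoc' (a := 1 + i) (b := 1 + i + (k + 2) - 1) (by omega) (by omega) ?_ ?_
          (by omega) (hm _ _ (by omega) (by omega) (by omega)) rfl
        · rw [hw]
          split_ifs <;> omega
        · rw [hw]
          split_ifs <;> omega
      · rw [Equiv.Perm.mul_apply, Equiv.swap_apply_def, hw]
        split_ifs <;> omega

end Factorization

section PermApp

variable {n : ℕ}

theorem permApp_one (x : ℕ) : permApp (1 : Equiv.Perm (Fin n)) x = x := by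
  unfold permApp
  split_ifs with h
  · simp only [Equiv.Perm.one_apply]
    omega
  · rfl

theorem permApp_mul (σ τ : Equiv.Perm (Fin n)) (x : ℕ) :
    permApp (σ * τ) x = permApp σ (permApp τ x) := by
  unfold permApp
  by_cases h : 1 ≤ x ∧ x ≤ n
  · have h' : 1 ≤ ((τ ⟨x - 1, by omega⟩ : Fin n) : ℕ) + 1 ∧
        ((τ ⟨x - 1, by omega⟩ : Fin n) : ℕ) + 1 ≤ n :=
      ⟨by omega, (τ ⟨x - 1, by omega⟩).isLt⟩
    simp only [dif_pos h, dif_pos h']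
    rfl
  · simp only [dif_neg h]

theorem permApp_sPerm {i : ℕ} (hi : 1 ≤ i) (hin : i < n) (x : ℕ) :
    permApp (sPerm n i) x = Equiv.swap i (i + 1) x := by
  simp only [permApp, sPerm, dif_pos (show 1 ≤ i ∧ i < n from ⟨hi, hin⟩)]
  rw [Equiv.swap_apply_def]
  split_ifs with h h1 h2 h1 h2
  · subst h1
    simp
  · subst h2
    simp only [Nat.add_sub_cancel, Equiv.swap_apply_right]
    omega
  · rw [Equiv.swap_apply_of_ne_of_ne]
    · simp only; omega
    · rw [Ne, Fin.mk.injEq]; omega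
    · rw [Ne, Fin.mk.injEq]; omega
  · omega
  · omega
  · rfl

theorem permApp_word {i : ℕ → ℕ} {k : ℕ} (hi : ∀ j, 1 ≤ j → j ≤ k → 1 ≤ i j ∧ i j < n) (x : ℕ) :
    permApp ((List.range k).map fun t => sPerm n (i (t + 1))).prod x = wordPerm i k x := by
  induction k generalizing x with
  | zero => simp [wordPerm, permApp_one]
  | succ k ih =>
    have hik := hi (k + 1) (by omega) le_rfl
    rw [List.range_succ, List.map_append, List.prod_append, List.map_singleton,
      List.prod_singleton, permApp_mul, permApp_sPerm hik.1 hik.2,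
      ih fun j h1 h2 => hi j h1 (by omega), wordPerm_succ, Equiv.Perm.mul_apply]

theorem permApp_mem (σ : Equiv.Perm (Fin n)) {x : ℕ} (hx : 1 ≤ x ∧ x ≤ n) :
    1 ≤ permApp σ x ∧ permApp σ x ≤ n := by
  rw [permApp, dif_pos hx]
  exact ⟨by omega, (σ ⟨x - 1, by omega⟩).isLt⟩

theorem permApp_w0Perm (x : ℕ) :
    permApp (w0Perm n) x = if 1 ≤ x ∧ x ≤ n then n + 1 - x else x := by
  unfold permApp w0Perm
  split_ifs with h
  · simp only [Equiv.coe_fn_mk]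
    omega
  · rfl

end PermApp

/-- An ideal filling is determined by its values on simple roots. -/
theorem eq_filling {n : ℕ} {μ : ℕ → ℕ → ℝ}
    (hμ0 : ∀ a b, 1 ≤ a → a < b → b ≤ n → 0 ≤ μ a b)
    (hμmax : ∀ a b, 1 ≤ a → a < b → b ≤ n → 2 ≤ b - a →
      μ a b = max (μ (a + 1) b) (μ a (b - 1))) {a b : ℕ} (ha : 1 ≤ a) (hab : a < b) (hb : b ≤ n) :
    μ a b = filling (fun k => (μ k (k + 1)).toNNReal) a b := by
  obtain ⟨d, rfl⟩ : ∃ d, b = a + d + 1 := ⟨b - a - 1, by omega⟩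
  induction d generalizing a with
  | zero => rw [add_zero, filling.succ_self, Real.coe_toNNReal _ (hμ0 a (a + 1) ha (by omega) hb)]
  | succ d ih =>
    rw [hμmax _ _ ha hab hb (by omega), show a + (d + 1) + 1 = a + 1 + d + 1 by omega,
      ih (by omega) (by omega) (by omega), show a + 1 + d + 1 - 1 = a + d + 1 by omega,
      ih ha (by omega) (by omega)]
    set c : ℕ → NNReal := fun k => (μ k (k + 1)).toNNReal
    refine le_antisymm (max_le (filling.mono (by omega) le_rfl) (filling.mono le_rfl (by omega))) ?_
    rw [filling.split (show a ≤ a + 1 by omega) (show a + 1 ≤ a + 1 + d + 1 by omega), max_comm]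
    exact max_le_max le_rfl (filling.mono le_rfl (by omega))

theorem sum_range_sub (n : ℕ) : ∑ t ∈ Finset.range (n - 1), (n - 1 - t) = n * (n - 1) / 2 := by
  rcases n with _ | n
  · rfl
  · rw [← Finset.sum_range_id, Finset.sum_range_succ', ← Finset.sum_range_reflect, add_zero]
    refine Finset.sum_congr (by simp) fun t ht => ?_
    have := Finset.mem_range.1 ht
    omega

/-- given a reduced expression for w₀ and an ideal filling μ, there exist
positive generalized Puiseux series m_j with Val(m_j) = μ_{β_j} such that the product
y_{i_1}(m_1⁻¹)⋯y_{i_N}(m_N⁻¹) is a Toeplitz matrix. -/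
theorem stmt1
    (n N : ℕ) (hn : 2 ≤ n) (hN : N = n * (n - 1) / 2)
    (i : ℕ → ℕ)
    (hirange : ∀ j, 1 ≤ j → j ≤ N → 1 ≤ i j ∧ i j ≤ n - 1)
    (hired : ((List.range N).map (fun t => sPerm n (i (t + 1)))).prod = w0Perm n)
    (β : ℕ → ℕ × ℕ)
    (hβ : ∀ j, β j =
      (permApp (((List.range (j - 1)).map (fun t => sPerm n (i (t + 1)))).prod) (i j),
       permApp (((List.range (j - 1)).map (fun t => sPerm n (i (t + 1)))).prod) (i j + 1)))
    (μ : ℕ → ℕ → ℝ)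
    (hμ0 : ∀ a b, 1 ≤ a → a < b → b ≤ n → 0 ≤ μ a b)
    (hμmax : ∀ a b, 1 ≤ a → a < b → b ≤ n → 2 ≤ b - a →
      μ a b = max (μ (a + 1) b) (μ a (b - 1))) :
    ∃ m : ℕ → GPS,
      (∀ j, 1 ≤ j → j ≤ N →
        m j ≠ 0 ∧ 0 < (m j).coeff (m j).order ∧ (m j).order = μ (β j).1 (β j).2) ∧
      (∀ a b : Fin n, ∀ (ha : (a : ℕ) + 1 < n) (hb : (b : ℕ) + 1 < n),
        (((List.range N).map (fun t => yMat n GPS (i (t + 1)) (m (t + 1))⁻¹)).prod) a b =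
        (((List.range N).map (fun t => yMat n GPS (i (t + 1)) (m (t + 1))⁻¹)).prod)
          ⟨(a : ℕ) + 1, ha⟩ ⟨(b : ℕ) + 1, hb⟩) := by
  subst hN
  have hi : ∀ j, 1 ≤ j → j ≤ n * (n - 1) / 2 → 1 ≤ i j ∧ i j < n := fun j h1 h2 => by
    have := hirange j h1 h2
    omega
  set c : ℕ → NNReal := fun k => (μ k (k + 1)).toNNReal with hc
  obtain ⟨x, M, hx, hM, hout, hout', hin, hin'⟩ := exists_chamber c n
  set z : ℕ → ℕ → GPS := fun i j => if 1 ≤ i ∧ i < j ∧ j ≤ n then (M i j)⁻¹ else 0 with hz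
  have hz1 : ∀ i j, 1 ≤ i → i < j → j ≤ n → z i j = (M i j)⁻¹ := fun i j h1 h2 h3 =>
    if_pos ⟨h1, h2, h3⟩
  have htoep := stairProd_toeplitz hx (fun i j h1 h2 h3 => (hM i j h1 h2 h3).ne_zero) hout hout'
    hin hin' hz1 (fun j => if_neg (by omega)) (fun i j h => if_neg (by omega))
  obtain ⟨w, hfac, hw⟩ := Factorization.exists_stair hM hz1 (show n - 1 < n by omega)
  have hwi : w = wordPerm i (n * (n - 1) / 2) := by
    ext a
    rw [← permApp_word hi, hired, permApp_w0Perm, hw]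
    split_ifs <;> omega
  rw [sum_range_sub, hwi] at hfac
  obtain ⟨m, hm, hA⟩ := hfac.exists_along hi
  refine ⟨m, fun j h1 h2 => ?_, fun a b ha hb => ?_⟩
  · obtain ⟨j, rfl⟩ : ∃ k, j = k + 1 := ⟨j - 1, by omega⟩
    have hi' : ∀ l, 1 ≤ l → l ≤ j → 1 ≤ i l ∧ i l < n := fun l h3 h4 => hi l h3 (by omega)
    have hij := hi (j + 1) h1 h2
    obtain ⟨hlt, hp⟩ := hm j (by omega)
    have hmem := permApp_mem (((List.range j).map fun t => sPerm n (i (t + 1))).prod)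
      (x := i (j + 1)) (by omega)
    have hmem' := permApp_mem (((List.range j).map fun t => sPerm n (i (t + 1))).prod)
      (x := i (j + 1) + 1) (by omega)
    rw [permApp_word hi'] at hmem hmem'
    rw [hβ, Nat.add_sub_cancel]
    simp only
    rw [permApp_word hi', permApp_word hi', eq_filling hμ0 hμmax hmem.1 hlt hmem'.2]
    exact ⟨hp.ne_zero, hp.order_eq ▸ hp.1, hp.order_eq⟩
  · rw [← hA]
    have h := htoep (a + 1) (b + 1) (by omega) (by omega) (by omega) (by omega)
    rw [entry, entry, dif_pos (by omega), dif_pos (by omega)] at h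
    exact h.symm
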